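/- arXiv:math/0702569 — 2 statements merged into one kernel-verified Lean document; each statement's English description precedes it below -/
import Mathlib

section
/- Let K be a field, S = K[x,y,z,w] the polynomial ring in four variables over K, and I ⊆ S a monomial ideal of height two such that S/I is Cohen–Macaulay. Then S/I is clean. -/
open MvPolynomial

/-- The depth of an `S`-module `M` with respect to an ideal `m`: the supremum of
lengths of `M`-regular sequences consisting of elements of `m`. -/
noncomputable def mDepth (S : Type*) [CommRing S] (m : Ideal S)
    (M : Type*) [AddCommGroup M] [Module S M] : ℕ∞ :=
  sSup {n : ℕ∞ | ∃ rs : List S, (rs.length : ℕ∞) = n ∧ (∀ r ∈ rs, r ∈ m) ∧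
    RingTheory.Sequence.IsRegular M rs}

/-- `M` is a Cohen–Macaulay `S`-module (w.r.t. the ideal `m`) if its depth with
respect to `m` equals its Krull dimension, i.e. the Krull dimension of `S ⧸ ann M`. -/
def IsCM (S : Type*) [CommRing S] (m : Ideal S)
    (M : Type*) [AddCommGroup M] [Module S M] : Prop :=
  (mDepth S m M : WithBot ℕ∞) = ringKrullDim (S ⧸ Module.annihilator S M)

/-- `F` is a prime filtration `I = F₀ ⊆ F₁ ⊆ ... ⊆ F_r = S` with
`F_i/F_{i-1} ≅ S/P_i` for prime ideals `P_i`. -/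
def IsPrimeFiltration {S : Type*} [CommRing S] (I : Ideal S) (r : ℕ)
    (F : Fin (r + 1) → Ideal S) (P : Fin r → Ideal S) : Prop :=
  F 0 = I ∧ F (Fin.last r) = ⊤ ∧ (∀ i : Fin r, F i.castSucc ≤ F i.succ) ∧
  ∀ i : Fin r, (P i).IsPrime ∧
    Nonempty ((↥(Submodule.map (F i.castSucc).mkQ (F i.succ))) ≃ₗ[S] (S ⧸ P i))

/-- `S/I` is clean: it has a prime filtration all of whose primes are minimal
primes of `I`. -/
def IsClean {S : Type*} [CommRing S] (I : Ideal S) : Prop :=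
  ∃ (r : ℕ) (F : Fin (r + 1) → Ideal S) (P : Fin r → Ideal S),
    IsPrimeFiltration I r F P ∧ ∀ i, P i ∈ I.minimalPrimes

/-- `S/I` is pretty clean: it has a prime filtration such that `i ≤ j` and
`P i ⊆ P j` imply `P i = P j`. -/
def IsPrettyClean {S : Type*} [CommRing S] (I : Ideal S) : Prop :=
  ∃ (r : ℕ) (F : Fin (r + 1) → Ideal S) (P : Fin r → Ideal S),
    IsPrimeFiltration I r F P ∧ ∀ i j : Fin r, i ≤ j → P i ≤ P j → P i = P j

/-- A (finitely generated) `S`-module `M` is clean: it has a filtration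
`0 = M₀ ⊆ M₁ ⊆ ... ⊆ M_r = M` with `M_i/M_{i-1} ≅ S/P_i` where each `P_i` is a
minimal prime of the support of `M`, i.e. a minimal prime over `ann M`. -/
def IsCleanModule (S : Type*) [CommRing S] (M : Type*) [AddCommGroup M] [Module S M] : Prop :=
  ∃ (r : ℕ) (F : Fin (r + 1) → Submodule S M) (P : Fin r → Ideal S),
    F 0 = ⊥ ∧ F (Fin.last r) = ⊤ ∧ (∀ i : Fin r, F i.castSucc ≤ F i.succ) ∧
    (∀ i : Fin r, (P i).IsPrime ∧
      Nonempty ((↥(F i.succ) ⧸ (Submodule.comap (F i.succ).subtype (F i.castSucc)))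
        ≃ₗ[S] (S ⧸ P i))) ∧
    ∀ i, P i ∈ (Module.annihilator S M).minimalPrimes

/-- An ideal of a polynomial ring is a monomial ideal if it is generated by monomials. -/
def IsMonomialIdeal {σ K : Type*} [CommSemiring K] (I : Ideal (MvPolynomial σ K)) : Prop :=
  ∃ G : Set (MvPolynomial σ K),
    (∀ g ∈ G, ∃ e : σ →₀ ℕ, g = MvPolynomial.monomial e 1) ∧ I = Ideal.span G

/-- The height of an ideal: the infimum of the heights of the primes containing it. -/
noncomputable def idealHeight {S : Type*} [CommRing S] (I : Ideal S) : ℕ∞ :=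
  sInf {n : ℕ∞ | ∃ q : PrimeSpectrum S, I ≤ q.asIdeal ∧ Order.height q = n}

variable {K : Type*} [Field K]

local notation "S" => MvPolynomial (Fin 4) K
local notation "m4" => (Ideal.span {(X 0 : MvPolynomial (Fin 4) K), X 1, X 2, X 3})

section Exponents

/-- No exponent that agrees with or is below `a` outside the coordinates `i` and `j` lies in `U`:
the monomial `x ^ a` is nonzero modulo `I` after inverting the variables `i` and `j`, where `U` is
the set of exponents of `I`. -/
def FreeAt (U : Set (Fin 4 →₀ ℕ)) (i j : Fin 4) (a : Fin 4 →₀ ℕ) : Prop :=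
  ∀ b : Fin 4 →₀ ℕ, (∀ p, p ≠ i → p ≠ j → b p ≤ a p) → b ∉ U

/-- The combinatorial conditions on the exponents of a monomial ideal `I` in four variables
that hold if `I` has height two and a Cohen-Macaulay quotient. -/
structure IsAdmissible (U : Set (Fin 4 →₀ ℕ)) : Prop where
  upper : IsUpperSet U
  exists_mem_eq_zero : ∀ i, ∃ b ∈ U, b i = 0
  exists_freeAt : ∀ a, a ∉ U → ∃ i j, i ≠ j ∧ FreeAt U i j a
  connected : ∀ i j k l a, [i, j, k, l].Nodup → FreeAt U i j a → FreeAt U k l a →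
    FreeAt U i k a ∨ FreeAt U i l a ∨ FreeAt U j k a ∨ FreeAt U j l a

variable {U : Set (Fin 4 →₀ ℕ)} {i j k l : Fin 4} {a b : Fin 4 →₀ ℕ}

lemma FreeAt.symm (h : FreeAt U i j a) : FreeAt U j i a :=
  fun b hb ↦ h b fun p hi hj ↦ hb p hj hi

lemma FreeAt.mono (h : FreeAt U i j b) (hab : ∀ p, p ≠ i → p ≠ j → a p ≤ b p) : FreeAt U i j a :=
  fun c hc ↦ h c fun p hi hj ↦ (hc p hi hj).trans (hab p hi hj)

lemma FreeAt.notMem (h : FreeAt U i j a) : a ∉ U := h a fun _ _ _ ↦ le_rfl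

lemma eq_or_eq_of_nodup : ∀ {i j k l : Fin 4}, [i, j, k, l].Nodup →
    ∀ p, p = i ∨ p = j ∨ p = k ∨ p = l := by decide

lemma FreeAt.mono_of_nodup (h : FreeAt U i j b) (hd : [i, j, k, l].Nodup) (hk : a k ≤ b k)
    (hl : a l ≤ b l) : FreeAt U i j a :=
  h.mono fun p hi hj ↦ by
    rcases eq_or_eq_of_nodup hd p with rfl | rfl | rfl | rfl <;> tauto

lemma nodup_swap_left (hd : [i, j, k, l].Nodup) : [j, i, k, l].Nodup := by grind

lemma nodup_swap_mid (hd : [i, j, k, l].Nodup) : [i, k, j, l].Nodup := by grind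

lemma nodup_swap_right (hd : [i, j, k, l].Nodup) : [i, j, l, k].Nodup := by grind

lemma exists_update_freeAt (hU : IsAdmissible U) (h : FreeAt U i j a) (hd : [i, j, k, l].Nodup) :
    ∃ n, a k ≤ n ∧ FreeAt U i j (a.update k n) ∧ ¬ FreeAt U i j (a.update k (n + 1)) := by
  classical
  obtain ⟨b, hbU, hbl⟩ := hU.exists_mem_eq_zero l
  have hex : ∃ n, ¬ FreeAt U i j (a.update k n) := by
    refine ⟨b k, fun hf ↦ hf b (fun p hi hj ↦ ?_) hbU⟩
    rcases eq_or_eq_of_nodup hd p with rfl | rfl | rfl | rfl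
    · exact absurd rfl hi
    · exact absurd rfl hj
    · simp
    · simp [hbl]
  have hlt : a k < Nat.find hex := by
    by_contra! hle
    refine Nat.find_spec hex (h.mono fun p _ _ ↦ ?_)
    rcases eq_or_ne p k with rfl | hp
    · simpa using hle
    · simp [hp]
  refine ⟨Nat.find hex - 1, by omega, ?_, ?_⟩
  · have := Nat.find_min hex (m := Nat.find hex - 1) (by omega)
    tauto
  · rw [Nat.sub_add_cancel (by omega)]
    exact Nat.find_spec hex

/-- The monomials with the exponents of `c` in the coordinates `k` and `l` and arbitrary exponents
in the coordinates `i` and `j` survive in the localization at `i` and `j`, and are killed there by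
the variables `k` and `l`. -/
structure IsFreeCorner (U : Set (Fin 4 →₀ ℕ)) (i j k l : Fin 4) (c : Fin 4 →₀ ℕ) : Prop where
  freeAt : FreeAt U i j c
  not_left : ∀ b : Fin 4 →₀ ℕ, c k < b k → c l ≤ b l → ¬ FreeAt U i j b
  not_right : ∀ b : Fin 4 →₀ ℕ, c k ≤ b k → c l < b l → ¬ FreeAt U i j b

/-- The graph of all pairs at which `a` is free is the path `k - i - j - l`. -/
structure IsPathAt (U : Set (Fin 4 →₀ ℕ)) (i j k l : Fin 4) (a : Fin 4 →₀ ℕ) : Prop where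
  ij : FreeAt U i j a
  ik : FreeAt U i k a
  jl : FreeAt U j l a
  not_kl : ¬ FreeAt U k l a
  not_il : ¬ FreeAt U i l a
  not_jk : ¬ FreeAt U j k a

lemma IsFreeCorner.swap (h : IsFreeCorner U i j k l a) : IsFreeCorner U i j l k a :=
  ⟨h.freeAt, fun b h1 h2 ↦ h.not_right b h2 h1, fun b h1 h2 ↦ h.not_left b h2 h1⟩

lemma exists_isFreeCorner (hU : IsAdmissible U) (h : FreeAt U i j a) (hd : [i, j, k, l].Nodup) :
    ∃ c, IsFreeCorner U i j k l c := by
  obtain ⟨n, -, h1, h2⟩ := exists_update_freeAt hU h hd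
  obtain ⟨m, hm, h3, h4⟩ := exists_update_freeAt hU h1 (nodup_swap_right hd)
  have hkl : k ≠ l := by grind
  have hlk := hkl.symm
  refine ⟨_, h3, fun b hk hl hf ↦ h2 (hf.mono_of_nodup hd ?_ ?_),
    fun b hk hl hf ↦ h4 (hf.mono_of_nodup hd ?_ ?_)⟩ <;>
  grind

lemma IsPathAt.exists_isFreeCorner (hU : IsAdmissible U) (hd : [i, j, k, l].Nodup)
    (hc : IsFreeCorner U i j k l a) (hbk : b k = a k) (hbl : b l = a l) (hb : IsPathAt U i j k l b) :
    ∃ c, IsFreeCorner U i k j l c ∧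
      ∀ d, d j = c j → d l = c l → ¬ IsPathAt U i k j l d ∧ ¬ IsPathAt U i k l j d := by
  have hd' := nodup_swap_mid hd
  have hjl : j ≠ l := by grind
  have hkl : k ≠ l := by grind
  have hil : i ≠ l := by grind
  obtain ⟨n, hn, h1, h2⟩ := exists_update_freeAt hU hb.ik hd'
  have hnik : ¬ FreeAt U i k (b.update l (b l + 1)) := by
    intro hf
    have hjl' : FreeAt U j l (b.update l (b l + 1)) :=
      hb.jl.mono fun p _ hp ↦ by simp [hp]
    have hle : ∀ p, b p ≤ b.update l (b l + 1) p := fun p ↦ by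
      simp only [Finsupp.update_apply]; split_ifs with h <;> simp [h]
    rcases hU.connected i k j l _ hd' hf hjl' with h | h | h | h
    · exact hc.not_right _ (by simp [hkl, hbk]) (by simp [hbl]) h
    · exact hb.not_il (h.mono fun p _ _ ↦ hle p)
    · exact hb.not_jk (h.symm.mono fun p _ _ ↦ hle p)
    · exact hb.not_kl (h.mono fun p _ _ ↦ hle p)
  refine ⟨b.update j n, ⟨h1, fun d hj hl hf ↦ h2 (hf.mono_of_nodup hd' ?_ ?_),
    fun d hj hl hf ↦ hnik (hf.mono_of_nodup hd' ?_ ?_)⟩, fun d hdj hdl ↦ ⟨fun hp ↦ ?_, fun hp ↦ ?_⟩⟩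
  · simpa using hj
  · simpa [hjl.symm] using hl
  · simpa [hjl] using hn.trans (by simpa using hj)
  · simpa [hjl.symm] using hl
  · have hdj' : b j ≤ d j := by simpa [hdj] using hn
    have hdl' : d l = b l := by simpa [hjl.symm] using hdl
    have hdk : d k ≤ b k := by
      by_contra! hlt
      exact hc.not_left d (by omega) (by omega) hp.ik
    have hdi : b i ≤ d i := by
      by_contra! hlt
      exact hp.not_kl (hb.jl.mono_of_nodup (k := i) (l := k) (by grind) hlt.le hdk)
    exact hb.not_kl (hp.jl.mono_of_nodup (k := i) (l := j) (by grind) hdi hdj')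
  · have hdj' : b j ≤ d j := by simpa [hdj] using hn
    have hdl' : d l = b l := by simpa [hjl.symm] using hdl
    have hdk : b k ≤ d k := by
      by_contra! hlt
      exact hp.not_il (hb.ij.mono_of_nodup hd hlt.le hdl'.le)
    exact hb.not_il (hp.ik.mono_of_nodup (k := j) (l := k) (by grind) hdj' hdk)

lemma IsAdmissible.exists_isFreeCorner_forall_not_isPathAt (hU : IsAdmissible U) (hne : U ≠ Set.univ) :
    ∃ i j k l c, [i, j, k, l].Nodup ∧ IsFreeCorner U i j k l c ∧
      ∀ d, d k = c k → d l = c l → ¬ IsPathAt U i j k l d ∧ ¬ IsPathAt U i j l k d := by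
  obtain ⟨a, ha⟩ := (Set.ne_univ_iff_exists_notMem U).1 hne
  obtain ⟨i, j, hij, hf⟩ := hU.exists_freeAt a ha
  obtain ⟨k, l, hd⟩ : ∃ k l, [i, j, k, l].Nodup := by
    clear hf; revert i j; decide
  obtain ⟨c, hc⟩ := exists_isFreeCorner hU hf hd
  by_cases hgood : ∀ d, d k = c k → d l = c l → ¬ IsPathAt U i j k l d ∧ ¬ IsPathAt U i j l k d
  · exact ⟨i, j, k, l, c, hd, hc, hgood⟩
  push Not at hgood
  obtain ⟨b, hk, hl, hb⟩ := hgood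
  by_cases hp : IsPathAt U i j k l b
  · obtain ⟨c', h⟩ := hp.exists_isFreeCorner hU hd hc hk hl
    exact ⟨i, k, j, l, c', nodup_swap_mid hd, h⟩
  · obtain ⟨c', h⟩ := (hb hp).exists_isFreeCorner hU (nodup_swap_right hd) hc.swap hl hk
    exact ⟨i, l, j, k, c', nodup_swap_mid (nodup_swap_right hd), h⟩

lemma exists_forall_not_freeAt_iff (hU : IsAdmissible U) (hd : [i, j, k, l].Nodup)
    (c : Fin 4 →₀ ℕ) : ∃ n, ∀ a : Fin 4 →₀ ℕ, a k = c k → a l = c l →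
      ((¬ FreeAt U j k a ∧ ¬ FreeAt U j l a) ↔ n ≤ a i) := by
  classical
  have hex : ∃ n, ¬ FreeAt U j k (c.update i n) ∧ ¬ FreeAt U j l (c.update i n) := by
    have key : ∀ k l : Fin 4, [i, j, k, l].Nodup →
        ∃ n, ∀ a : Fin 4 →₀ ℕ, n ≤ a i → ¬ FreeAt U j k a := fun k l hd ↦ by
      obtain ⟨b, hbU, hbl⟩ := hU.exists_mem_eq_zero l
      refine ⟨b i, fun a ha hf ↦ hf b (fun p hj hk ↦ ?_) hbU⟩
      rcases eq_or_eq_of_nodup hd p with rfl | rfl | rfl | rfl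
      · exact ha
      · exact absurd rfl hj
      · exact absurd rfl hk
      · simp [hbl]
    obtain ⟨n, hn⟩ := key k l hd
    obtain ⟨m, hm⟩ := key l k (nodup_swap_right hd)
    exact ⟨max n m, hn _ (by simp), hm _ (by simp)⟩
  have hki : k ≠ i := by grind
  have hli : l ≠ i := by grind
  refine ⟨Nat.find hex, fun a hk hl ↦ ⟨fun h ↦ Nat.find_min' hex ?_, fun h ↦ ?_⟩⟩
  · exact ⟨fun hf ↦ h.1 (hf.mono_of_nodup (k := i) (l := l) (by grind) (by simp) (by simp [hli, hl])),
      fun hf ↦ h.2 (hf.mono_of_nodup (k := i) (l := k) (by grind) (by simp) (by simp [hki, hk]))⟩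
  · have := Nat.find_spec hex
    exact ⟨fun hf ↦ this.1
      (hf.mono_of_nodup (k := i) (l := l) (by grind) (by simpa using h) (by simp [hli, hl])),
      fun hf ↦ this.2
      (hf.mono_of_nodup (k := i) (l := k) (by grind) (by simpa using h) (by simp [hki, hk]))⟩

lemma IsAdmissible.union_Ici {c : Fin 4 →₀ ℕ} (hU : IsAdmissible U) (hd : [i, j, k, l].Nodup)
    (hc : IsFreeCorner U i j k l c)
    (hpath : ∀ d, d k = c k → d l = c l → ¬ IsPathAt U i j k l d ∧ ¬ IsPathAt U i j l k d)
    (hiso : ∀ p q, p ≠ q → FreeAt U p q c → (p = i ∧ q = j) ∨ (p = j ∧ q = i))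
    (hmin : ∀ a : Fin 4 →₀ ℕ, a k = c k → a l = c l → ¬ FreeAt U i k a → ¬ FreeAt U i l a →
      ¬ FreeAt U j k a → ¬ FreeAt U j l a → c ≤ a) :
    IsAdmissible (U ∪ Set.Ici c) := by
  have hle : ∀ {p q a}, FreeAt (U ∪ Set.Ici c) p q a → FreeAt U p q a :=
    fun h b hb hbU ↦ h b hb (Or.inl hbU)
  have hge : ∀ {p q a}, p ≠ q → FreeAt U p q a →
      ¬ ((p = i ∧ q = j) ∨ (p = j ∧ q = i)) → FreeAt (U ∪ Set.Ici c) p q a := by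
    intro p q a hpq h hne b hb hbU
    rcases hbU with hbU | hcb
    · exact h b hb hbU
    · exact hne (hiso p q hpq (h.mono fun r hp hq ↦ (hcb r).trans (hb r hp hq)))
  have heq : ∀ {a}, FreeAt U i j a → ¬ FreeAt (U ∪ Set.Ici c) i j a → a k = c k ∧ a l = c l := by
    intro a h hn
    have hij : i ≠ j := by grind
    have : c k ≤ a k ∧ c l ≤ a l := by
      simp only [FreeAt, not_forall, not_not] at hn
      obtain ⟨b, hb, hbU | hcb⟩ := hn
      · exact absurd hbU (h b hb)
      · exact ⟨(hcb k).trans (hb k (by grind) (by grind)), (hcb l).trans (hb l (by grind) (by grind))⟩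
    constructor
    · by_contra hne
      exact hc.not_left a (by omega) this.2 h
    · by_contra hne
      exact hc.not_right a this.1 (by omega) h
  have hij : i ≠ j := by grind
  have hik : i ≠ k := by grind
  have hil : i ≠ l := by grind
  have hjk : j ≠ k := by grind
  have hjl : j ≠ l := by grind
  have hkl : k ≠ l := by grind
  refine ⟨hU.upper.union (isUpperSet_Ici c), fun p ↦ ?_, fun a ha ↦ ?_, fun p q r s a hpqrs h1 h2 ↦ ?_⟩
  · obtain ⟨b, hb, h0⟩ := hU.exists_mem_eq_zero p
    exact ⟨b, Or.inl hb, h0⟩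
  · by_contra! hcon
    have hnot : ∀ p q, p ≠ q → ¬ ((p = i ∧ q = j) ∨ (p = j ∧ q = i)) → ¬ FreeAt U p q a :=
      fun p q hpq hne h ↦ hcon p q hpq (hge hpq h hne)
    obtain ⟨p, q, hpq, h⟩ := hU.exists_freeAt a fun h ↦ ha (Or.inl h)
    have hf : FreeAt U i j a := by
      by_contra hn
      refine hnot p q hpq ?_ h
      rintro (⟨rfl, rfl⟩ | ⟨rfl, rfl⟩)
      · exact hn h
      · exact hn h.symm
    obtain ⟨hk, hl⟩ := heq hf (hcon i j hij)
    exact ha (Or.inr (hmin a hk hl (hnot _ _ hik (by grind)) (hnot _ _ hil (by grind))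
      (hnot _ _ hjk (by grind)) (hnot _ _ hjl (by grind))))
  · have key : ∀ p q r s, [p, q, r, s].Nodup → FreeAt U p q a → FreeAt U r s a → FreeAt U p r a →
        ¬ FreeAt (U ∪ Set.Ici c) p r a → ¬ FreeAt (U ∪ Set.Ici c) p s a →
        ¬ FreeAt (U ∪ Set.Ici c) q r a → FreeAt (U ∪ Set.Ici c) q s a := by
      intro p q r s hpqrs hpq hrs hpr npr nps nqr
      by_contra nqs
      have hnot : ∀ {p q}, p ≠ q → ¬ ((p = i ∧ q = j) ∨ (p = j ∧ q = i)) →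
          ¬ FreeAt (U ∪ Set.Ici c) p q a → ¬ FreeAt U p q a :=
        fun hpq hne hn h ↦ hn (hge hpq h hne)
      have hpr' : (p = i ∧ r = j) ∨ (p = j ∧ r = i) := by
        by_contra hne
        exact npr (hge (by grind) hpr hne)
      have nps' := hnot (by grind) (by grind) nps
      have nqr' := hnot (by grind) (by grind) nqr
      have nqs' := hnot (by grind) (by grind) nqs
      rcases hpr' with ⟨rfl, rfl⟩ | ⟨rfl, rfl⟩
      · obtain ⟨hk, hl⟩ := heq hpr npr
        have : (q = k ∧ s = l) ∨ (q = l ∧ s = k) := by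
          have := eq_or_eq_of_nodup hd q
          have := eq_or_eq_of_nodup hd s
          grind
        rcases this with ⟨rfl, rfl⟩ | ⟨rfl, rfl⟩
        · exact (hpath a hk hl).1 ⟨hpr, hpq, hrs, nqs', nps', fun h ↦ nqr' h.symm⟩
        · exact (hpath a hk hl).2 ⟨hpr, hpq, hrs, nqs', nps', fun h ↦ nqr' h.symm⟩
      · obtain ⟨hk, hl⟩ := heq hpr.symm fun h ↦ npr h.symm
        have : (q = k ∧ s = l) ∨ (q = l ∧ s = k) := by
          have := eq_or_eq_of_nodup hd q
          have := eq_or_eq_of_nodup hd s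
          grind
        rcases this with ⟨rfl, rfl⟩ | ⟨rfl, rfl⟩
        · exact (hpath a hk hl).2
            ⟨hpr.symm, hrs, hpq, fun h ↦ nqs' h.symm, fun h ↦ nqr' h.symm, nps'⟩
        · exact (hpath a hk hl).1
            ⟨hpr.symm, hrs, hpq, fun h ↦ nqs' h.symm, fun h ↦ nqr' h.symm, nps'⟩
    by_contra! hcon
    obtain ⟨npr, nps, nqr, nqs⟩ := hcon
    rcases hU.connected p q r s a hpqrs (hle h1) (hle h2) with h | h | h | h
    · exact nqs (key p q r s hpqrs (hle h1) (hle h2) h npr nps nqr)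
    · exact nqr (key p q s r (nodup_swap_right hpqrs) (hle h1) (hle h2).symm h nps npr nqs)
    · exact nps (key q p r s (nodup_swap_left hpqrs) (hle h1).symm (hle h2) h nqr nqs npr)
    · exact npr (key q p s r (nodup_swap_right (nodup_swap_left hpqrs)) (hle h1).symm (hle h2).symm
        h nqs nqr nps)

/-- The exponents of a nonzero monomial `x ^ c` modulo `I` whose annihilator is the prime generated
by the variables `k` and `l`, such that adding `x ^ c` to `I` preserves admissibility. -/
lemma IsAdmissible.exists_step (hU : IsAdmissible U) (hne : U ≠ Set.univ) :
    ∃ k l c, k ≠ l ∧ c ∉ U ∧ (∀ b, b + c ∈ U ↔ b k ≠ 0 ∨ b l ≠ 0) ∧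
      IsAdmissible (U ∪ Set.Ici c) := by
  obtain ⟨i, j, k, l, c₀, hd, hc₀, hpath₀⟩ :=
    hU.exists_isFreeCorner_forall_not_isPathAt hne
  obtain ⟨n, hn⟩ := exists_forall_not_freeAt_iff hU hd c₀
  obtain ⟨m, hm⟩ := exists_forall_not_freeAt_iff hU (nodup_swap_left hd) c₀
  obtain ⟨c, hci, hcj, hck, hcl⟩ :
      ∃ c : Fin 4 →₀ ℕ, c i = n ∧ c j = m ∧ c k = c₀ k ∧ c l = c₀ l := by
    refine ⟨(c₀.update i n).update j m, ?_⟩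
    simp only [Finsupp.update_apply]
    grind
  have hc : IsFreeCorner U i j k l c :=
    ⟨hc₀.freeAt.mono_of_nodup hd hck.le hcl.le,
      fun b hk hl ↦ hc₀.not_left b (hck ▸ hk) (hcl ▸ hl),
      fun b hk hl ↦ hc₀.not_right b (hck ▸ hk) (hcl ▸ hl)⟩
  obtain ⟨njk, njl⟩ := (hn c hck hcl).2 hci.ge
  obtain ⟨nik, nil⟩ := (hm c hck hcl).2 hcj.ge
  have nkl : ¬ FreeAt U k l c := fun h ↦ by
    have := hU.connected i j k l c hd hc.freeAt h
    tauto
  have hiso : ∀ p q, p ≠ q → FreeAt U p q c → (p = i ∧ q = j) ∨ (p = j ∧ q = i) := by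
    intro p q hpq h
    have h' := h.symm
    rcases eq_or_eq_of_nodup hd p with rfl | rfl | rfl | rfl <;>
    rcases eq_or_eq_of_nodup hd q with rfl | rfl | rfl | rfl <;> tauto
  refine ⟨k, l, c, by grind, hc.freeAt.notMem, fun b ↦ ⟨fun hb ↦ ?_, fun hb ↦ ?_⟩, ?_⟩
  · by_contra! h0
    refine hc.freeAt _ (fun p hi hj ↦ ?_) hb
    rcases eq_or_eq_of_nodup hd p with rfl | rfl | rfl | rfl
    · exact absurd rfl hi
    · exact absurd rfl hj
    · simp [h0.1]
    · simp [h0.2]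
  · by_contra hbU
    have hnot : ¬ FreeAt U i j (b + c) := by
      rcases hb with hb | hb
      · exact hc.not_left _ (by simp; omega) (by simp)
      · exact hc.not_right _ (by simp) (by simp; omega)
    obtain ⟨p, q, hpq, hf⟩ := hU.exists_freeAt _ hbU
    rcases hiso p q hpq (hf.mono fun r _ _ ↦ by simp) with ⟨rfl, rfl⟩ | ⟨rfl, rfl⟩
    · exact hnot hf
    · exact hnot hf.symm
  · refine hU.union_Ici hd hc (fun d hk hl ↦ hpath₀ d (hk.trans hck) (hl.trans hcl)) hiso ?_
    intro a hk hl nik nil njk njl p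
    rcases eq_or_eq_of_nodup hd p with rfl | rfl | rfl | rfl
    · exact hci ▸ (hn a (hk.trans hck) (hl.trans hcl)).1 ⟨njk, njl⟩
    · exact hcj ▸ (hm a (hk.trans hck) (hl.trans hcl)).1 ⟨nik, nil⟩
    · exact hk.ge
    · exact hl.ge

end Exponents

section PrimeFiltration

variable {A : Type*} [CommRing A]

lemma isPrimeFiltration_top (P : Fin 0 → Ideal A) : IsPrimeFiltration ⊤ 0 (fun _ ↦ ⊤) P :=
  ⟨rfl, rfl, fun i ↦ i.elim0, fun i ↦ i.elim0⟩

lemma nonempty_map_mkQ_sup_span_singleton_equiv {I P : Ideal A} {u : A}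
    (hu : ∀ b, b * u ∈ I ↔ b ∈ P) :
    Nonempty (↥(Submodule.map I.mkQ (I ⊔ Ideal.span {u})) ≃ₗ[A] (A ⧸ P)) := by
  have hker : LinearMap.ker (LinearMap.toSpanSingleton A (A ⧸ I) (I.mkQ u)) = P := by
    ext b
    rw [LinearMap.mem_ker, LinearMap.toSpanSingleton_apply, ← map_smul, Submodule.mkQ_apply,
      Submodule.Quotient.mk_eq_zero, smul_eq_mul, hu]
  have hrange : LinearMap.range (LinearMap.toSpanSingleton A (A ⧸ I) (I.mkQ u)) =
      Submodule.map I.mkQ (I ⊔ Ideal.span {u}) := by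
    rw [LinearMap.range_toSpanSingleton, Submodule.map_sup, Ideal.span, Submodule.map_span,
      Set.image_singleton, I.mkQ_map_self, bot_sup_eq]
  exact ⟨((Submodule.quotEquivOfEq _ _ hker).symm ≪≫ₗ LinearMap.quotKerEquivRange _ ≪≫ₗ
    LinearEquiv.ofEq _ _ hrange).symm⟩

lemma IsPrimeFiltration.cons {I P : Ideal A} {u : A} (hP : P.IsPrime)
    (hu : ∀ b, b * u ∈ I ↔ b ∈ P) {r : ℕ} {F : Fin (r + 1) → Ideal A} {Q : Fin r → Ideal A}
    (h : IsPrimeFiltration (I ⊔ Ideal.span {u}) r F Q) :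
    IsPrimeFiltration I (r + 1) (Fin.cons I F : Fin (r + 2) → Ideal A) (Fin.cons P Q) := by
  obtain ⟨h0, hl, hle, hq⟩ := h
  refine ⟨rfl, by rw [← Fin.succ_last, Fin.cons_succ, hl], fun i ↦ ?_, fun i ↦ ?_⟩
  · refine Fin.cases ?_ (fun i ↦ ?_) i
    · simp [h0]
    · simpa using hle i
  · refine Fin.cases ?_ (fun i ↦ ?_) i
    · refine ⟨hP, ?_⟩
      change Nonempty (↥(Submodule.map I.mkQ (F 0)) ≃ₗ[A] (A ⧸ P))
      rw [h0]
      exact nonempty_map_mkQ_sup_span_singleton_equiv hu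
    · exact hq i

end PrimeFiltration

section MonomialIdeals

variable {σ : Type*}

lemma sub_aeval_mem_span_X_image (s : Set σ) [DecidablePred (· ∈ s)] (p : MvPolynomial σ K) :
    p - aeval (fun i ↦ if i ∈ s then 0 else (X i : MvPolynomial σ K)) p ∈
      Ideal.span (X '' s : Set (MvPolynomial σ K)) := by
  rw [← Ideal.Quotient.eq]
  have : (Ideal.Quotient.mkₐ K (Ideal.span (X '' s : Set (MvPolynomial σ K)))).comp
      (aeval fun i ↦ if i ∈ s then 0 else (X i : MvPolynomial σ K)) =
      Ideal.Quotient.mkₐ K (Ideal.span (X '' s : Set (MvPolynomial σ K))) := by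
    ext i
    by_cases hi : i ∈ s
    · simp only [AlgHom.comp_apply, aeval_X, hi, if_true, map_zero]
      exact (Ideal.Quotient.eq_zero_iff_mem.2 (Ideal.subset_span (Set.mem_image_of_mem X hi))).symm
    · simp [hi]
  exact (DFunLike.congr_fun this p).symm

lemma isPrime_span_X_image (s : Set σ) :
    (Ideal.span (X '' s : Set (MvPolynomial σ K))).IsPrime := by
  classical
  have : Ideal.span (X '' s : Set (MvPolynomial σ K)) =
      RingHom.ker (aeval (R := K) fun i ↦ if i ∈ s then 0 else (X i : MvPolynomial σ K)) := by
    refine le_antisymm (Ideal.span_le.2 ?_) fun p hp ↦ ?_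
    · rintro _ ⟨i, hi, rfl⟩
      simp [hi]
    · have := sub_aeval_mem_span_X_image s p
      rwa [(RingHom.mem_ker).1 hp, sub_zero] at this
  rw [this]
  exact RingHom.ker_isPrime _

lemma X_mem_span_X_image_iff {s : Set σ} {i : σ} :
    (X i : MvPolynomial σ K) ∈ Ideal.span (X '' s : Set (MvPolynomial σ K)) ↔ i ∈ s := by
  classical
  rw [mem_ideal_span_X_image, support_X]
  simp [Finsupp.single_apply]

lemma exists_X_mem_of_monomial_mem {q : Ideal (MvPolynomial σ K)} (hq : q.IsPrime) {b : σ →₀ ℕ}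
    (h : monomial b 1 ∈ q) : ∃ i, b i ≠ 0 ∧ X i ∈ q := by
  rw [monomial_eq, C_1, one_mul, Finsupp.prod, hq.prod_mem_iff] at h
  obtain ⟨i, hi, h⟩ := h
  exact ⟨i, Finsupp.mem_support_iff.1 hi, hq.mem_of_pow_mem _ h⟩

variable (K) in
/-- The ideal generated by the monomials with exponents in `U`. -/
noncomputable def monomialSpan (U : Set (σ →₀ ℕ)) : Ideal (MvPolynomial σ K) :=
  Ideal.span ((fun e ↦ monomial e 1) '' U)

lemma mem_monomialSpan {U : Set (σ →₀ ℕ)} (hU : IsUpperSet U) {p : MvPolynomial σ K} :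
    p ∈ monomialSpan K U ↔ ∀ e ∈ p.support, e ∈ U := by
  rw [monomialSpan, mem_ideal_span_monomial_image]
  exact forall₂_congr fun e _ ↦ ⟨fun ⟨s, hs, hle⟩ ↦ hU hle hs, fun h ↦ ⟨e, h, le_rfl⟩⟩

lemma monomial_mem_monomialSpan {U : Set (σ →₀ ℕ)} (hU : IsUpperSet U) {e : σ →₀ ℕ} :
    monomial e 1 ∈ monomialSpan K U ↔ e ∈ U := by
  classical
  rw [mem_monomialSpan hU, support_monomial]
  simp

lemma monomialSpan_union_Ici (U : Set (σ →₀ ℕ)) (c : σ →₀ ℕ) :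
    monomialSpan K (U ∪ Set.Ici c) = monomialSpan K U ⊔ Ideal.span {monomial c 1} := by
  refine le_antisymm (Ideal.span_le.2 ?_) (sup_le (Ideal.span_mono (by gcongr; simp)) ?_)
  · rintro _ ⟨e, he | he, rfl⟩
    · exact Ideal.mem_sup_left (Ideal.subset_span ⟨e, he, rfl⟩)
    · refine Ideal.mem_sup_right (Ideal.mem_span_singleton.2 ⟨monomial (e - c) 1, ?_⟩)
      rw [monomial_mul, one_mul, add_tsub_cancel_of_le he]
  · rw [Ideal.span_singleton_le_iff_mem]
    exact Ideal.subset_span ⟨c, Or.inr Set.self_mem_Ici, rfl⟩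

lemma mul_monomial_mem_monomialSpan {U : Set (σ →₀ ℕ)} (hU : IsUpperSet U) {c : σ →₀ ℕ}
    {p : MvPolynomial σ K} :
    p * monomial c 1 ∈ monomialSpan K U ↔ ∀ e ∈ p.support, e + c ∈ U := by
  rw [mem_monomialSpan hU]
  refine ⟨fun h e he ↦ h _ ?_, fun h e he ↦ ?_⟩
  · rw [mem_support_iff, coeff_mul_monomial]
    simpa using he
  · rw [mem_support_iff, coeff_mul_monomial'] at he
    split_ifs at he with hc
    · simpa [tsub_add_cancel_of_le hc] using h (e - c) (by simpa using he)
    · exact absurd rfl he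

lemma IsMonomialIdeal.exists_eq_monomialSpan {I : Ideal (MvPolynomial σ K)}
    (hI : IsMonomialIdeal I) : ∃ U : Set (σ →₀ ℕ), IsUpperSet U ∧ I = monomialSpan K U := by
  obtain ⟨G, hG, rfl⟩ := hI
  refine ⟨{e | monomial e 1 ∈ Ideal.span G}, fun e e' hle he ↦ ?_,
    le_antisymm (Ideal.span_le.2 fun g hg ↦ ?_) (Ideal.span_le.2 ?_)⟩
  · have : (monomial e' 1 : MvPolynomial σ K) = monomial (e' - e) 1 * monomial e 1 := by
      rw [monomial_mul, one_mul, tsub_add_cancel_of_le hle]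
    change monomial e' 1 ∈ Ideal.span G
    rw [this]
    exact Ideal.mul_mem_left _ _ he
  · obtain ⟨e, rfl⟩ := hG g hg
    exact Ideal.subset_span ⟨e, Ideal.subset_span hg, rfl⟩
  · rintro _ ⟨e, he, rfl⟩
    exact he

lemma IsAdmissible.exists_isPrimeFiltration {U : Set (Fin 4 →₀ ℕ)} (hU : IsAdmissible U) :
    ∃ (r : ℕ) (F : Fin (r + 1) → Ideal S) (P : Fin r → Ideal S),
      IsPrimeFiltration (monomialSpan K U) r F P ∧
      ∀ i, monomialSpan K U ≤ P i ∧ ∃ k l, P i = Ideal.span (X '' {k, l}) := by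
  generalize hI : monomialSpan K U = I
  induction I using WellFoundedGT.induction generalizing U with
  | ind I ih =>
  subst hI
  by_cases hne : U = Set.univ
  · have : monomialSpan K U = ⊤ := (Ideal.eq_top_iff_one _).2 <|
      (monomial_mem_monomialSpan hU.upper (e := 0)).2 (by simp [hne])
    rw [this]
    exact ⟨0, _, fun i ↦ i.elim0, isPrimeFiltration_top _, fun i ↦ i.elim0⟩
  · obtain ⟨k, l, c, -, hc, hcolon, hU'⟩ := hU.exists_step hne
    have hlt : monomialSpan K U < monomialSpan K (U ∪ Set.Ici c) := by
      refine lt_of_le_of_ne (by rw [monomialSpan_union_Ici]; exact le_sup_left) fun h ↦ hc ?_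
      rw [← monomial_mem_monomialSpan (K := K) hU.upper, h, monomial_mem_monomialSpan hU'.upper]
      exact Or.inr Set.self_mem_Ici
    obtain ⟨r, F, P, hF, hP⟩ := ih _ hlt hU' rfl
    have hu : ∀ b : S, b * monomial c 1 ∈ monomialSpan K U ↔ b ∈ Ideal.span (X '' {k, l}) := by
      intro b
      rw [mul_monomial_mem_monomialSpan hU.upper, mem_ideal_span_X_image]
      exact forall₂_congr fun e _ ↦ by simp [hcolon]
    rw [monomialSpan_union_Ici] at hF
    refine ⟨r + 1, _, _, hF.cons (isPrime_span_X_image _) hu, fun i ↦ ?_⟩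
    refine Fin.cases ?_ (fun i ↦ ?_) i
    · exact ⟨fun b hb ↦ (hu b).1 (Ideal.mul_mem_right _ _ hb), k, l, rfl⟩
    · exact ⟨hlt.le.trans (hP i).1, (hP i).2⟩

lemma IsAdmissible.isClean {U : Set (Fin 4 →₀ ℕ)} (hU : IsAdmissible U) :
    IsClean (monomialSpan K U) := by
  obtain ⟨r, F, P, hF, hP⟩ := hU.exists_isPrimeFiltration (K := K)
  refine ⟨r, F, P, hF, fun i ↦ ⟨⟨(hF.2.2.2 i).1, (hP i).1⟩, fun q ⟨hq, hle⟩ hqP ↦ ?_⟩⟩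
  obtain ⟨k, l, hkl⟩ := (hP i).2
  rw [hkl] at hqP ⊢
  have key : ∀ k l, q ≤ Ideal.span (X '' {k, l}) → k ≠ l → X k ∈ q := by
    intro k l hqP hne
    obtain ⟨b, hb, hbl⟩ := hU.exists_mem_eq_zero l
    obtain ⟨p, hp, hpq⟩ := exists_X_mem_of_monomial_mem hq
      (hle ((monomial_mem_monomialSpan hU.upper).2 hb))
    rcases X_mem_span_X_image_iff.1 (hqP hpq) with rfl | rfl
    · exact hpq
    · exact absurd hbl hp
  have hne : k ≠ l := by
    rintro rfl
    obtain ⟨b, hb, hbk⟩ := hU.exists_mem_eq_zero k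
    obtain ⟨p, hp, hpq⟩ := exists_X_mem_of_monomial_mem hq
      (hle ((monomial_mem_monomialSpan hU.upper).2 hb))
    have := X_mem_span_X_image_iff.1 (hqP hpq)
    simp at this
    exact hp (this ▸ hbk)
  refine Ideal.span_le.2 ?_
  rintro _ ⟨p, rfl | rfl, rfl⟩
  · exact key _ _ hqP hne
  · exact key _ _ (by rwa [Set.pair_comm]) hne.symm

end MonomialIdeals

section RegularPairs

variable {A : Type*} [CommRing A] {I : Ideal A} {f g : A}

/-- `f, g` is a weakly regular sequence on `A ⧸ I`, expressed by elements of `A`. -/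
structure IsRegularPair (I : Ideal A) (f g : A) : Prop where
  mem_of_mul_mem : ∀ p, f * p ∈ I → p ∈ I
  exists_sub_mem : ∀ p q, g * p - f * q ∈ I → ∃ r, p - f * r ∈ I

lemma IsRegularPair.pow_mul_mem (h : IsRegularPair I f g) (s : ℕ) {p : A} (hp : f ^ s * p ∈ I) :
    p ∈ I := by
  induction s with
  | zero => simpa using hp
  | succ s ih => exact ih (h.mem_of_mul_mem _ (by convert hp using 1; ring))

lemma IsRegularPair.pow_left (h : IsRegularPair I f g) (s : ℕ) : IsRegularPair I (f ^ s) g := by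
  refine ⟨fun p hp ↦ h.pow_mul_mem s hp, ?_⟩
  induction s with
  | zero => exact fun p q _ ↦ ⟨p, by simp⟩
  | succ s ih =>
    intro p q hpq
    obtain ⟨r, hr⟩ := h.exists_sub_mem p (f ^ s * q) (by convert hpq using 1; ring)
    obtain ⟨t, ht⟩ := ih r q <| h.mem_of_mul_mem _ <| by
      convert I.sub_mem hpq (I.mul_mem_left g hr) using 1; ring
    exact ⟨t, by convert I.add_mem hr (I.mul_mem_left f ht) using 1; ring⟩

lemma IsRegularPair.pow_right (h : IsRegularPair I f g) (t : ℕ) : IsRegularPair I f (g ^ t) := by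
  refine ⟨h.mem_of_mul_mem, ?_⟩
  induction t with
  | zero => exact fun p q hpq ↦ ⟨q, by simpa using hpq⟩
  | succ t ih =>
    intro p q hpq
    obtain ⟨r, hr⟩ := ih (g * p) q (by convert hpq using 1; ring)
    exact h.exists_sub_mem p r hr

lemma IsRegularPair.exists_mem (h : IsRegularPair I f g) {J : Ideal A} (hf : f ∈ J.radical)
    (hg : g ∈ J.radical) : ∃ a ∈ J, ∃ b ∈ J, IsRegularPair I a b := by
  obtain ⟨s, hs⟩ := hf
  obtain ⟨t, ht⟩ := hg
  exact ⟨f ^ s, hs, g ^ t, ht, (h.pow_left s).pow_right t⟩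

lemma isRegularPair_of_isRegular {rs : List A}
    (h : RingTheory.Sequence.IsRegular (A ⧸ I) (f :: g :: rs)) : IsRegularPair I f g := by
  rw [RingTheory.Sequence.isRegular_cons_iff, RingTheory.Sequence.isRegular_cons_iff] at h
  obtain ⟨hf, hg, -⟩ := h
  have key : ∀ p : A, p ∈ I ↔ (Ideal.Quotient.mk I p : A ⧸ I) = 0 :=
    fun p ↦ Ideal.Quotient.eq_zero_iff_mem.symm
  refine ⟨fun p hp ↦ ?_, fun p q hpq ↦ ?_⟩
  · rw [key] at hp ⊢
    refine hf ?_
    change f • (Ideal.Quotient.mk I p : A ⧸ I) = f • 0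
    rw [smul_zero]
    exact hp
  · have h0 : g • (Submodule.Quotient.mk (Ideal.Quotient.mk I p) : QuotSMulTop f (A ⧸ I)) = 0 := by
      rw [← Submodule.Quotient.mk_smul, Submodule.Quotient.mk_eq_zero,
        Submodule.mem_smul_pointwise_iff_exists]
      refine ⟨Ideal.Quotient.mk I q, trivial, ?_⟩
      exact (Ideal.Quotient.eq.2 hpq).symm
    have h1 := hg (h0.trans (smul_zero g).symm)
    rw [Submodule.Quotient.mk_eq_zero, Submodule.mem_smul_pointwise_iff_exists] at h1
    obtain ⟨r, -, hr⟩ := h1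
    obtain ⟨r, rfl⟩ := Ideal.Quotient.mk_surjective r
    exact ⟨r, Ideal.Quotient.eq.1 hr.symm⟩

lemma exists_isRegularPair_of_two_le_mDepth {m : Ideal A} (h : 2 ≤ mDepth A m (A ⧸ I)) :
    ∃ f ∈ m, ∃ g ∈ m, IsRegularPair I f g := by
  have h1 : (1 : ℕ∞) < mDepth A m (A ⧸ I) := lt_of_lt_of_le (by norm_num) h
  obtain ⟨n, ⟨rs, rfl, hm, hrs⟩, hlt⟩ := lt_sSup_iff.1 h1
  match rs, hm, hrs, hlt with
  | [], _, _, hlt => simp at hlt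
  | [_], _, _, hlt => simp at hlt
  | f :: g :: rs, hm, hrs, _ =>
    exact ⟨f, hm f (by simp), g, hm g (by simp), isRegularPair_of_isRegular hrs⟩

end RegularPairs

section Dimension

variable {σ : Type*}

variable (K) in
/-- The prime ideal generated by the variables in `s`. -/
noncomputable def varPrime (s : Set σ) : PrimeSpectrum (MvPolynomial σ K) :=
  ⟨Ideal.span (X '' s), isPrime_span_X_image s⟩

lemma varPrime_strictMono : StrictMono (varPrime K : Set σ → PrimeSpectrum (MvPolynomial σ K)) := by
  intro s t hst
  refine lt_of_le_of_ne (Ideal.span_mono (Set.image_mono hst.le)) fun h ↦ ?_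
  obtain ⟨i, hit, his⟩ := Set.exists_of_ssubset hst
  refine his ((X_mem_span_X_image_iff (K := K)).1 ?_)
  have : Ideal.span (X '' s : Set (MvPolynomial σ K)) = Ideal.span (X '' t) :=
    congrArg PrimeSpectrum.asIdeal h
  rw [this]
  exact X_mem_span_X_image_iff.2 hit

lemma card_le_height_varPrime (s : Finset σ) :
    (s.card : ℕ∞) ≤ Order.height (varPrime K (s : Set σ)) := by
  classical
  induction s using Finset.induction_on with
  | empty => simp
  | insert i s hi ih =>
    rw [Finset.card_insert_of_notMem hi]
    push_cast
    refine (add_le_add_left ih 1).trans (Order.height_add_one_le (varPrime_strictMono ?_))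
    simpa using Set.ssubset_insert (by simpa using hi)

lemma monomialSpan_le_varPrime {U : Set (σ →₀ ℕ)} {q : PrimeSpectrum (MvPolynomial σ K)}
    (h : monomialSpan K U ≤ q.asIdeal) :
    monomialSpan K U ≤ (varPrime K {i | X i ∈ q.asIdeal}).asIdeal := by
  refine Ideal.span_le.2 ?_
  rintro _ ⟨e, he, rfl⟩
  obtain ⟨i, hi, hiq⟩ := exists_X_mem_of_monomial_mem q.2 (h (Ideal.subset_span ⟨e, he, rfl⟩))
  refine mem_ideal_span_X_image.2 fun e' he' ↦ ⟨i, hiq, ?_⟩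
  rw [Finset.mem_singleton.1 (support_monomial_subset he')]
  exact hi

lemma two_le_ringKrullDim_quotient {U : Set (Fin 4 →₀ ℕ)}
    (hht : idealHeight (monomialSpan K U) = 2) : 2 ≤ ringKrullDim (S ⧸ monomialSpan K U) := by
  classical
  obtain ⟨q, hq, hq2⟩ : ∃ q : PrimeSpectrum S, monomialSpan K U ≤ q.asIdeal ∧
      Order.height q < 3 := by
    have : idealHeight (monomialSpan K U) < 3 := by rw [hht]; norm_num
    obtain ⟨_, ⟨q, hq, rfl⟩, hlt⟩ := sInf_lt_iff.1 this
    exact ⟨q, hq, hlt⟩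
  obtain ⟨T, hT⟩ : ∃ T : Finset (Fin 4), (T : Set (Fin 4)) = {i | X i ∈ q.asIdeal} :=
    ⟨Finset.univ.filter fun i ↦ X i ∈ q.asIdeal, by simp⟩
  have hle : monomialSpan K U ≤ (varPrime K (T : Set (Fin 4))).asIdeal :=
    hT ▸ monomialSpan_le_varPrime hq
  have hTq : varPrime K (T : Set (Fin 4)) ≤ q := by
    refine Ideal.span_le.2 ?_
    rintro _ ⟨i, hi, rfl⟩
    rw [hT] at hi
    exact hi
  have hcard : T.card < 3 := by
    have := ((card_le_height_varPrime (K := K) T).trans (Order.height_mono hTq)).trans_lt hq2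
    exact_mod_cast this
  obtain ⟨i, hi⟩ : ∃ i, i ∉ T := by
    by_contra! h
    rw [Finset.eq_univ_iff_forall.2 h] at hcard
    simp at hcard
  obtain ⟨j, hj⟩ : ∃ j, j ∉ insert i T := by
    by_contra! h
    have h1 := Finset.card_insert_le i T
    rw [Finset.eq_univ_iff_forall.2 h] at h1
    simp at h1
    omega
  have h1 : varPrime K (T : Set (Fin 4)) < varPrime K (insert i T : Finset (Fin 4)) :=
    varPrime_strictMono (Finset.coe_ssubset.2 (Finset.ssubset_insert hi))
  have h2 : varPrime K ((insert i T : Finset (Fin 4)) : Set (Fin 4)) <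
      varPrime K (insert j (insert i T) : Finset (Fin 4)) :=
    varPrime_strictMono (Finset.coe_ssubset.2 (Finset.ssubset_insert hj))
  rw [ringKrullDim_quotient]
  let c : LTSeries (PrimeSpectrum.zeroLocus (monomialSpan K U : Set S)) :=
    { length := 2
      toFun := ![⟨_, hle⟩, ⟨_, hle.trans h1.le⟩, ⟨_, hle.trans (h1.trans h2).le⟩]
      step := fun p ↦ by
        fin_cases p
        · exact h1
        · exact h2 }
  exact Order.LTSeries.length_le_krullDim c

lemma exists_mem_apply_eq_zero [Finite σ] {U : Set (σ →₀ ℕ)}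
    (hht : idealHeight (monomialSpan K U) = 2) (i : σ) : ∃ b ∈ U, b i = 0 := by
  by_contra! hcon
  have hle : monomialSpan K U ≤ (varPrime K {i}).asIdeal := by
    refine Ideal.span_le.2 ?_
    rintro _ ⟨e, he, rfl⟩
    refine mem_ideal_span_X_image.2 fun e' he' ↦ ⟨i, rfl, ?_⟩
    rw [Finset.mem_singleton.1 (support_monomial_subset he')]
    exact hcon e he
  have h1 : Order.height (varPrime K ({i} : Set σ)) ≤ 1 := by
    rw [← PrimeSpectrum.height_eq_orderHeight]
    refine Ideal.height_le_one_of_isPrincipal_of_mem_minimalPrimes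
      (Ideal.span {(X i : MvPolynomial σ K)}) _ ?_
    have : (varPrime K ({i} : Set σ)).asIdeal = Ideal.span {X i} := by
      simp [varPrime]
    rw [this]
    have : (Ideal.span {(X i : MvPolynomial σ K)}).IsPrime := by
      rw [← this]; exact (varPrime K {i}).2
    rw [Ideal.minimalPrimes_eq_subsingleton_self]
    rfl
  have h2 : (2 : ℕ∞) ≤ 1 := hht ▸ (sInf_le ⟨_, hle, rfl⟩ : idealHeight (monomialSpan K U) ≤ _).trans h1
  norm_num at h2

end Dimension

section CohenMacaulay

variable {U : Set (Fin 4 →₀ ℕ)} {i j k l : Fin 4}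

lemma X_pow_mul_monomial (i : Fin 4) (n : ℕ) (a : Fin 4 →₀ ℕ) :
    (X i ^ n * monomial a 1 : S) = monomial (Finsupp.single i n + a) 1 := by
  rw [X_pow_eq_monomial, monomial_mul, one_mul]

lemma span_X_le_radical {J : Ideal S} {n : ℕ} (h : ∀ i, X i ^ n ∈ J) : m4 ≤ J.radical := by
  refine Ideal.span_le.2 ?_
  rintro _ (rfl | rfl | rfl | rfl) <;> exact ⟨n, h _⟩

lemma exists_forall_mem_of_not_freeAt (hU : IsUpperSet U) (a : Fin 4 →₀ ℕ) :
    ∃ N, ∀ i j, ¬ FreeAt U i j a →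
      ∀ b : Fin 4 →₀ ℕ, a ≤ b → N ≤ b i → N ≤ b j → b ∈ U := by
  have : ∀ i j, ∃ N, ¬ FreeAt U i j a →
      ∀ b : Fin 4 →₀ ℕ, a ≤ b → N ≤ b i → N ≤ b j → b ∈ U := by
    intro i j
    by_cases h : FreeAt U i j a
    · exact ⟨0, fun hn ↦ absurd h hn⟩
    · simp only [FreeAt, not_forall, not_not] at h
      obtain ⟨c, hc, hcU⟩ := h
      refine ⟨max (c i) (c j), fun _ b hab hi hj ↦ hU (fun p ↦ ?_) hcU⟩
      rcases eq_or_ne p i with rfl | hpi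
      · exact (le_max_left _ _).trans hi
      rcases eq_or_ne p j with rfl | hpj
      · exact (le_max_right _ _).trans hj
      · exact (hc p hpi hpj).trans (hab p)
  choose N hN using this
  refine ⟨Finset.univ.sup fun p : Fin 4 × Fin 4 ↦ N p.1 p.2, fun i j h b hab hi hj ↦ ?_⟩
  have hle : N i j ≤ Finset.univ.sup fun p : Fin 4 × Fin 4 ↦ N p.1 p.2 :=
    Finset.le_sup (f := fun p : Fin 4 × Fin 4 ↦ N p.1 p.2) (Finset.mem_univ (i, j))
  exact hN i j h b hab (hle.trans hi) (hle.trans hj)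

lemma FreeAt.add_notMem {a : Fin 4 →₀ ℕ} (h : FreeAt U i j a) (n : ℕ) :
    Finsupp.single i n + a ∉ U :=
  h _ fun p hp _ ↦ by simp [hp.symm]

lemma connected_of_isRegularPair {f g : S} (hU : IsUpperSet U) (hf : f ∈ m4) (hg : g ∈ m4)
    (h : IsRegularPair (monomialSpan K U) f g) {a : Fin 4 →₀ ℕ} (hd : [i, j, k, l].Nodup)
    (hij : FreeAt U i j a) (hkl : FreeAt U k l a) :
    FreeAt U i k a ∨ FreeAt U i l a ∨ FreeAt U j k a ∨ FreeAt U j l a := by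
  by_contra! hcon
  obtain ⟨nik, nil, njk, njl⟩ := hcon
  obtain ⟨N, hN⟩ := exists_forall_mem_of_not_freeAt hU a
  have hcross : ∀ p q, ¬ FreeAt U p q a →
      (X p ^ N * X q ^ N * monomial a 1 : S) ∈ monomialSpan K U := by
    intro p q hpq
    rw [mul_assoc, X_pow_mul_monomial, X_pow_mul_monomial, monomial_mem_monomialSpan hU]
    exact hN p q hpq _ (fun r ↦ by simp [← add_assoc])
      (by simp [← add_assoc]; try omega) (by simp [← add_assoc]; try omega)
  have hJ : ∀ p, (X p ^ N : S) ∈ Ideal.span {X i ^ N, X j ^ N} ⊔ Ideal.span {X k ^ N, X l ^ N} := by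
    intro p
    rcases eq_or_eq_of_nodup hd p with rfl | rfl | rfl | rfl
    · exact Ideal.mem_sup_left (Ideal.subset_span (by simp))
    · exact Ideal.mem_sup_left (Ideal.subset_span (by simp))
    · exact Ideal.mem_sup_right (Ideal.subset_span (by simp))
    · exact Ideal.mem_sup_right (Ideal.subset_span (by simp))
  obtain ⟨A, hA, B, hB, hAB⟩ := h.exists_mem (span_X_le_radical hJ hf) (span_X_le_radical hJ hg)
  obtain ⟨A₁, hA₁, A₂, hA₂, rfl⟩ := Submodule.mem_sup.1 hA
  obtain ⟨B₁, hB₁, B₂, hB₂, rfl⟩ := Submodule.mem_sup.1 hB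
  have hprod : ∀ p ∈ Ideal.span {(X i ^ N : S), X j ^ N},
      ∀ q ∈ Ideal.span {(X k ^ N : S), X l ^ N}, p * q * monomial a 1 ∈ monomialSpan K U := by
    intro p hp q hq
    obtain ⟨p₁, p₂, rfl⟩ := Ideal.mem_span_pair.1 hp
    obtain ⟨q₁, q₂, rfl⟩ := Ideal.mem_span_pair.1 hq
    have := Ideal.add_mem _ (Ideal.add_mem _ (Ideal.mul_mem_left _ (p₁ * q₁) (hcross i k nik))
      (Ideal.mul_mem_left _ (p₁ * q₂) (hcross i l nil)))
      (Ideal.add_mem _ (Ideal.mul_mem_left _ (p₂ * q₁) (hcross j k njk))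
      (Ideal.mul_mem_left _ (p₂ * q₂) (hcross j l njl)))
    convert this using 1
    ring
  obtain ⟨v, hv⟩ := hAB.exists_sub_mem (A₁ * monomial a 1) (B₁ * monomial a 1) <| by
    convert Ideal.sub_mem _ (hprod _ hA₁ _ hB₂) (hprod _ hB₁ _ hA₂) using 1
    ring
  have hi : X i ^ N * (v - monomial a 1) ∈ monomialSpan K U := by
    refine hAB.mem_of_mul_mem _ ?_
    have h1 := hprod (X i ^ N) (Ideal.subset_span (by simp)) _ hA₂
    convert Ideal.neg_mem_iff _ |>.2 (Ideal.add_mem _ (Ideal.mul_mem_left _ (X i ^ N) hv) h1) using 1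
    ring
  have hk : X k ^ N * v ∈ monomialSpan K U := by
    refine hAB.mem_of_mul_mem _ ?_
    have h1 := hprod _ hA₁ (X k ^ N) (Ideal.subset_span (by simp))
    convert Ideal.sub_mem _ h1 (Ideal.mul_mem_left _ (X k ^ N) hv) using 1
    ring
  rw [mul_comm, X_pow_eq_monomial, mul_monomial_mem_monomialSpan hU] at hi hk
  have hvi : coeff a (v - monomial a 1) = 0 := by
    by_contra hne
    exact hij.add_notMem N (by simpa [add_comm] using hi a (mem_support_iff.2 hne))
  have hvk : coeff a v = 0 := by
    by_contra hne
    exact hkl.add_notMem N (by simpa [add_comm] using hk a (mem_support_iff.2 hne))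
  simp [hvk] at hvi

lemma exists_freeAt_of_isRegularPair {f g : S} (hU : IsUpperSet U) (hf : f ∈ m4) (hg : g ∈ m4)
    (h : IsRegularPair (monomialSpan K U) f g) {a : Fin 4 →₀ ℕ} (ha : a ∉ U) :
    ∃ i j, i ≠ j ∧ FreeAt U i j a := by
  by_contra! hcon
  obtain ⟨N, hN⟩ := exists_forall_mem_of_not_freeAt hU a
  obtain ⟨i, hi⟩ : ∃ i, Finsupp.single i N + a ∉ U := by
    by_contra! hall
    have hJ : ∀ p, (X p ^ N : S) ∈ (monomialSpan K U).colon {monomial a 1} := by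
      intro p
      rw [Submodule.mem_colon_singleton, smul_eq_mul, X_pow_mul_monomial,
        monomial_mem_monomialSpan hU]
      exact hall p
    obtain ⟨A, hA, B, hB, hAB⟩ := h.exists_mem (span_X_le_radical hJ hf) (span_X_le_radical hJ hg)
    rw [Submodule.mem_colon_singleton, smul_eq_mul] at hA
    exact ha ((monomial_mem_monomialSpan (K := K) hU).1 (hAB.mem_of_mul_mem _ hA))
  set w : S := monomial (Finsupp.single i N + a) 1 with hw
  set M := N + a i + 1 with hM
  have hJ : ∀ p, (X p ^ M : S) ∈ Ideal.span {X i ^ M} ⊔ (monomialSpan K U).colon {w} := by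
    intro p
    rcases eq_or_ne i p with rfl | hp
    · exact Ideal.mem_sup_left (Ideal.subset_span rfl)
    · refine Ideal.mem_sup_right ?_
      rw [Submodule.mem_colon_singleton, smul_eq_mul, hw, X_pow_mul_monomial,
        monomial_mem_monomialSpan hU]
      exact hN i p (hcon i p hp) _ (fun r ↦ by simp [← add_assoc]) (by simp [← add_assoc]; omega) (by simp; omega)
  obtain ⟨A, hA, B, hB, hAB⟩ := h.exists_mem (span_X_le_radical hJ hf) (span_X_le_radical hJ hg)
  obtain ⟨A₁, hA₁, A₂, hA₂, rfl⟩ := Submodule.mem_sup.1 hA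
  obtain ⟨B₁, hB₁, B₂, hB₂, rfl⟩ := Submodule.mem_sup.1 hB
  obtain ⟨α, rfl⟩ := Ideal.mem_span_singleton'.1 hA₁
  obtain ⟨β, rfl⟩ := Ideal.mem_span_singleton'.1 hB₁
  rw [Submodule.mem_colon_singleton, smul_eq_mul] at hA₂ hB₂
  obtain ⟨v, hv⟩ := hAB.exists_sub_mem (α * w) (β * w) <| by
    convert Ideal.sub_mem _ (Ideal.mul_mem_left _ α hB₂) (Ideal.mul_mem_left _ β hA₂) using 1
    ring
  have hmem : v * X i ^ M - w ∈ monomialSpan K U := by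
    refine hAB.mem_of_mul_mem _ ?_
    convert Ideal.neg_mem_iff _ |>.2
      (Ideal.add_mem _ (Ideal.mul_mem_left _ (X i ^ M) hv) hA₂) using 1
    ring
  refine hi ((mem_monomialSpan hU).1 hmem _ (mem_support_iff.2 ?_))
  have hlt : ¬ Finsupp.single i M ≤ Finsupp.single i N + a := fun hle ↦ by
    have := hle i
    simp at this
    omega
  rw [coeff_sub, X_pow_eq_monomial, coeff_mul_monomial', if_neg hlt, hw, coeff_monomial, if_pos rfl]
  simp

lemma isAdmissible_of_isCM (hU : IsUpperSet U) (hht : idealHeight (monomialSpan K U) = 2)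
    (hCM : IsCM S m4 (S ⧸ monomialSpan K U)) : IsAdmissible U := by
  have h2 : 2 ≤ mDepth S m4 (S ⧸ monomialSpan K U) := by
    have := two_le_ringKrullDim_quotient hht
    rw [IsCM, Ideal.annihilator_quotient] at hCM
    rw [← hCM] at this
    exact WithBot.coe_le_coe.1 this
  obtain ⟨f, hf, g, hg, h⟩ := exists_isRegularPair_of_two_le_mDepth h2
  exact ⟨hU, exists_mem_apply_eq_zero hht, fun a ↦ exists_freeAt_of_isRegularPair hU hf hg h,
    fun i j k l a hd ↦ connected_of_isRegularPair hU hf hg h hd⟩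

end CohenMacaulay

/-- If `I ⊆ K[x,y,z,w]` is a monomial ideal of height two such
that `S/I` is Cohen–Macaulay, then `S/I` is clean. -/
theorem stmt_3 (I : Ideal S) (hI : IsMonomialIdeal I)
    (hht : idealHeight I = 2) (hCM : IsCM S m4 (S ⧸ I)) :
    IsClean I := by
  obtain ⟨U, hU, rfl⟩ := hI.exists_eq_monomialSpan
  exact (isAdmissible_of_isCM hU hht hCM).isClean
end

section
/- Let K be a field, S = K[x₁,...,xₙ] a polynomial ring over K, I ⊆ S a monomial ideal, and I = D_{−1}(I) ⊆ D_0(I) ⊆ ... ⊆ D_{n−1}(I) = S the dimension filtration of S/I. Then the following are equivalent: (1) S/I is pretty clean; (2) S/I is sequentially Cohen–Macaulay and all nonzero factors D_i(I)/D_{i−1}(I) of the dimension filtration are clean S-modules; (3) all nonzero factors D_i(I)/D_{i−1}(I) of the dimension filtration are clean S-modules. -/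
open MvPolynomial

variable {K : Type*} [Field K] {n : ℕ}

local notation "Sn" => MvPolynomial (Fin n) K
local notation "mn" => (Ideal.span (Set.range (MvPolynomial.X : Fin n → MvPolynomial (Fin n) K)))

section Filtration

variable {R M N : Type*} [CommRing R] [AddCommGroup M] [Module R M] [AddCommGroup N] [Module R N]

/-- `B` is generated over `A` by one element whose annihilator modulo `A` is `P`,
i.e. `A ≤ B` and `B / A ≅ R / P`. -/
def CyclicStep (A B : Submodule R M) (P : Ideal R) : Prop :=
  ∃ g, B = A ⊔ Submodule.span R {g} ∧ ∀ c : R, c • g ∈ A ↔ c ∈ P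

/-- There is a filtration from `A` to `B` whose successive factors are cyclic, with the
given list of annihilators. -/
inductive CyclicFiltration : Submodule R M → Submodule R M → List (Ideal R) → Prop
  | refl (A : Submodule R M) : CyclicFiltration A A []
  | cons {A B C : Submodule R M} {P : Ideal R} {L : List (Ideal R)} :
      CyclicStep A B P → CyclicFiltration B C L → CyclicFiltration A C (P :: L)

namespace CyclicStep

variable {A B : Submodule R M} {P : Ideal R}

lemma le (h : CyclicStep A B P) : A ≤ B := by
  obtain ⟨g, rfl, -⟩ := h
  exact le_sup_left

lemma smul_mem (h : CyclicStep A B P) {c : R} (hc : c ∈ P) {x : M} (hx : x ∈ B) :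
    c • x ∈ A := by
  obtain ⟨g, rfl, hg⟩ := h
  obtain ⟨a, ha, b, hb, rfl⟩ := Submodule.mem_sup.1 hx
  obtain ⟨r, rfl⟩ := Submodule.mem_span_singleton.1 hb
  rw [smul_add, smul_comm]
  exact A.add_mem (A.smul_mem _ ha) (A.smul_mem _ ((hg c).2 hc))

lemma map (h : CyclicStep A B P) (f : M →ₗ[R] N) (hf : LinearMap.ker f ≤ A) :
    CyclicStep (A.map f) (B.map f) P := by
  obtain ⟨g, rfl, hg⟩ := h
  refine ⟨f g, ?_, fun c => ?_⟩
  · rw [Submodule.map_sup, Submodule.map_span, Set.image_singleton]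
  · rw [← hg, ← map_smul, ← Submodule.mem_comap, Submodule.comap_map_eq, sup_eq_left.2 hf]

lemma comap (h : CyclicStep A B P) (f : N →ₗ[R] M) (hf : B ≤ LinearMap.range f) :
    CyclicStep (A.comap f) (B.comap f) P := by
  obtain ⟨g, rfl, hg⟩ := h
  obtain ⟨g, rfl⟩ := hf (Submodule.mem_sup_right (Submodule.mem_span_singleton_self g))
  refine ⟨g, le_antisymm (fun x hx => ?_) (sup_le (Submodule.comap_mono le_sup_left) ?_),
    fun c => ?_⟩
  · obtain ⟨a, ha, b, hb, hab⟩ := Submodule.mem_sup.1 (Submodule.mem_comap.1 hx)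
    obtain ⟨r, rfl⟩ := Submodule.mem_span_singleton.1 hb
    have hx' : x = (x - r • g) + r • g := by abel
    rw [hx']
    refine Submodule.add_mem_sup ?_ (Submodule.smul_mem _ _ (Submodule.mem_span_singleton_self g))
    rw [Submodule.mem_comap, map_sub, map_smul, ← hab, add_sub_cancel_right]
    exact ha
  · rw [Submodule.span_singleton_le_iff_mem]
    exact Submodule.mem_sup_right (Submodule.mem_span_singleton_self _)
  · rw [← hg, Submodule.mem_comap, map_smul]

lemma nonempty_equiv_iff (hAB : A ≤ B) (π : B →ₗ[R] N) (hπ : Function.Surjective π)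
    (hker : ∀ x : B, π x = 0 ↔ (x : M) ∈ A) :
    Nonempty (N ≃ₗ[R] R ⧸ P) ↔ CyclicStep A B P := by
  constructor
  · rintro ⟨e⟩
    obtain ⟨y, hy⟩ := e.surjective (Ideal.Quotient.mk P 1)
    obtain ⟨g, rfl⟩ := hπ y
    have hsmul (c : R) : e (π (c • g)) = Ideal.Quotient.mk P c := by
      rw [map_smul, map_smul, hy, map_one, Algebra.smul_def, mul_one]
      rfl
    refine ⟨g, le_antisymm (fun x hx => ?_) (sup_le hAB ?_), fun c => ?_⟩
    · obtain ⟨c, hc⟩ := Ideal.Quotient.mk_surjective (e (π ⟨x, hx⟩))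
      rw [← hsmul] at hc
      have h0 : π (⟨x, hx⟩ - c • g) = 0 := by rw [map_sub, ← e.injective hc, sub_self]
      have hx' : x = (x - c • (g : M)) + c • (g : M) := by abel
      rw [hx']
      exact Submodule.add_mem_sup ((hker _).1 h0)
        (Submodule.smul_mem _ _ (Submodule.mem_span_singleton_self _))
    · rw [Submodule.span_singleton_le_iff_mem]
      exact g.2
    · rw [← Ideal.Quotient.eq_zero_iff_mem, ← hsmul, LinearEquiv.map_eq_zero_iff, hker]
      rfl
  · rintro ⟨g, hB, hg⟩
    have hgB : g ∈ B := hB ▸ Submodule.mem_sup_right (Submodule.mem_span_singleton_self g)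
    let ψ : R →ₗ[R] N := LinearMap.toSpanSingleton R N (π ⟨g, hgB⟩)
    have hψ : Function.Surjective ψ := by
      intro y
      obtain ⟨⟨x, hx⟩, rfl⟩ := hπ y
      obtain ⟨a, ha, b, hb, hab⟩ := Submodule.mem_sup.1 (hB ▸ hx)
      obtain ⟨r, rfl⟩ := Submodule.mem_span_singleton.1 hb
      refine ⟨r, ?_⟩
      rw [LinearMap.toSpanSingleton_apply, ← map_smul, ← sub_eq_zero, ← map_sub, hker]
      simpa [← hab] using ha
    have hk : LinearMap.ker ψ = P := by
      ext c
      rw [LinearMap.mem_ker, LinearMap.toSpanSingleton_apply, ← map_smul, hker, ← hg]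
      rfl
    exact ⟨((Submodule.quotEquivOfEq _ _ hk).symm.trans
      (LinearMap.quotKerEquivOfSurjective ψ hψ)).symm⟩

lemma nonempty_quotient_equiv_iff (hAB : A ≤ B) :
    Nonempty ((↥B ⧸ A.comap B.subtype) ≃ₗ[R] R ⧸ P) ↔ CyclicStep A B P :=
  nonempty_equiv_iff hAB (Submodule.mkQ _) (Submodule.mkQ_surjective _) fun x => by
    rw [Submodule.mkQ_apply, Submodule.Quotient.mk_eq_zero]
    rfl

lemma nonempty_map_mkQ_equiv_iff (hAB : A ≤ B) :
    Nonempty ((↥(B.map A.mkQ)) ≃ₗ[R] R ⧸ P) ↔ CyclicStep A B P :=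
  nonempty_equiv_iff hAB (A.mkQ.submoduleMap B) (LinearMap.submoduleMap_surjective _ _)
    fun x => by
      rw [← Submodule.coe_eq_zero, LinearMap.submoduleMap_coe_apply, Submodule.mkQ_apply,
        Submodule.Quotient.mk_eq_zero]

end CyclicStep

namespace CyclicFiltration

variable {A B C : Submodule R M} {P : Ideal R} {L L' : List (Ideal R)}

lemma le (h : CyclicFiltration A B L) : A ≤ B := by
  induction h with
  | refl A => exact le_rfl
  | cons h _ ih => exact h.le.trans ih

lemma append (h : CyclicFiltration A B L) (h' : CyclicFiltration B C L') :
    CyclicFiltration A C (L ++ L') := by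
  induction h with
  | refl A => exact h'
  | cons h _ ih => exact .cons h (ih h')

lemma concat (h : CyclicFiltration A B L) (h' : CyclicStep B C P) :
    CyclicFiltration A C (L ++ [P]) :=
  h.append (.cons h' (.refl C))

lemma map (h : CyclicFiltration A B L) (f : M →ₗ[R] N) (hf : LinearMap.ker f ≤ A) :
    CyclicFiltration (A.map f) (B.map f) L := by
  induction h with
  | refl A => exact .refl _
  | cons h _ ih => exact .cons (h.map f hf) (ih (hf.trans h.le))

lemma comap (h : CyclicFiltration A B L) (f : N →ₗ[R] M) (hf : B ≤ LinearMap.range f) :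
    CyclicFiltration (A.comap f) (B.comap f) L := by
  induction h with
  | refl A => exact .refl _
  | cons h h' ih => exact .cons (h.comap f (h'.le.trans hf)) (ih hf)

lemma exists_notMem_smul_mem (h : CyclicFiltration A B L) {q : Ideal R} (hq : q.IsPrime)
    (hL : ∀ P ∈ L, ¬ P ≤ q) : ∃ s ∉ q, ∀ x ∈ B, s • x ∈ A := by
  induction h with
  | refl A => exact ⟨1, fun h => hq.ne_top ((Ideal.eq_top_iff_one _).2 h), fun x hx => by simpa⟩
  | @cons A B C P L h _ ih =>
    obtain ⟨s, hs, hsx⟩ := ih fun P hP => hL P (List.mem_cons_of_mem _ hP)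
    obtain ⟨t, ht, htq⟩ := SetLike.not_le_iff_exists.1 (hL _ List.mem_cons_self)
    refine ⟨t * s, fun hts => (hq.mem_or_mem hts).elim htq hs, fun x hx => ?_⟩
    rw [mul_smul]
    exact h.smul_mem ht (hsx x hx)

lemma annihilator_le (h : CyclicFiltration (⊥ : Submodule R M) ⊤ L) (hP : P ∈ L) :
    Module.annihilator R M ≤ P := by
  intro c hc
  rw [Module.mem_annihilator] at hc
  generalize (⊥ : Submodule R M) = A, (⊤ : Submodule R M) = B at h
  induction h with
  | refl => simp at hP
  | cons h _ ih =>
    obtain ⟨g, -, hg⟩ := h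
    rcases List.mem_cons.1 hP with rfl | hP
    · rw [← hg, hc]
      exact zero_mem _
    · exact ih hP

lemma exists_le_of_annihilator_le (h : CyclicFiltration (⊥ : Submodule R M) ⊤ L) {q : Ideal R}
    (hq : q.IsPrime) (hle : Module.annihilator R M ≤ q) : ∃ P ∈ L, P ≤ q := by
  by_contra! H
  obtain ⟨s, hs, hsx⟩ := h.exists_notMem_smul_mem hq H
  exact hs (hle (Module.mem_annihilator.2 fun x => by simpa using hsx x trivial))

lemma of_fin {r : ℕ} {F : Fin (r + 1) → Submodule R M} {P : Fin r → Ideal R}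
    (h : ∀ i : Fin r, CyclicStep (F i.castSucc) (F i.succ) (P i)) :
    CyclicFiltration (F 0) (F (Fin.last r)) (List.ofFn P) := by
  induction r with
  | zero => simpa using CyclicFiltration.refl (F 0)
  | succ r ih =>
    rw [List.ofFn_succ]
    refine .cons (h 0) ?_
    have := @ih (fun i => F i.succ) (fun i => P i.succ) fun i => by
      simpa using h i.succ
    simpa using this

lemma exists_fin (h : CyclicFiltration A B L) :
    ∃ F : Fin (L.length + 1) → Submodule R M, F 0 = A ∧ F (Fin.last _) = B ∧
      ∀ i : Fin L.length, CyclicStep (F i.castSucc) (F i.succ) (L.get i) := by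
  induction h with
  | refl A => exact ⟨fun _ => A, rfl, rfl, fun i => i.elim0⟩
  | @cons A B C P L h _ ih =>
    obtain ⟨F, hF0, hF1, hF⟩ := ih
    refine ⟨Fin.cons A F, rfl, by rw [← hF1]; rfl, fun i => ?_⟩
    refine Fin.cases ?_ (fun j => ?_) i
    · simpa [hF0] using h
    · simpa using hF j

end CyclicFiltration

lemma isCleanModule_iff_cyclicFiltration :
    IsCleanModule R M ↔ ∃ L : List (Ideal R), CyclicFiltration (⊥ : Submodule R M) ⊤ L ∧
      ∀ P ∈ L, P.IsPrime ∧ P ∈ (Module.annihilator R M).minimalPrimes := by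
  constructor
  · rintro ⟨r, F, P, h0, h1, hle, hF, hP⟩
    refine ⟨List.ofFn P, h0 ▸ h1 ▸ .of_fin fun i =>
      (CyclicStep.nonempty_quotient_equiv_iff (hle i)).1 (hF i).2, fun p hp => ?_⟩
    obtain ⟨i, rfl⟩ := (List.mem_ofFn' P p).1 hp
    exact ⟨(hF i).1, hP i⟩
  · rintro ⟨L, h, hL⟩
    obtain ⟨F, h0, h1, hF⟩ := h.exists_fin
    exact ⟨L.length, F, L.get, h0, h1, fun i => (hF i).le, fun i => ⟨(hL _ (L.get_mem i)).1,
      (CyclicStep.nonempty_quotient_equiv_iff (hF i).le).2 (hF i)⟩,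
      fun i => (hL _ (L.get_mem i)).2⟩

lemma isPrettyClean_of_cyclicFiltration {I : Ideal R} {L : List (Ideal R)}
    (h : CyclicFiltration I ⊤ L) (hL : ∀ P ∈ L, P.IsPrime)
    (hp : L.Pairwise fun P Q => P ≤ Q → P = Q) : IsPrettyClean I := by
  obtain ⟨F, h0, h1, hF⟩ := h.exists_fin
  refine ⟨L.length, F, L.get, ⟨h0, h1, fun i => (hF i).le, fun i => ⟨hL _ (L.get_mem i),
    (CyclicStep.nonempty_map_mkQ_equiv_iff (hF i).le).2 (hF i)⟩⟩, fun i j hij hle => ?_⟩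
  rcases hij.eq_or_lt with rfl | hij
  · rfl
  · exact List.pairwise_iff_get.1 hp i j hij hle

lemma IsPrettyClean.exists_nat {I : Ideal R} (h : IsPrettyClean I) :
    ∃ (r : ℕ) (F P : ℕ → Ideal R), F 0 = I ∧ F r = ⊤ ∧
      (∀ k < r, (P k).IsPrime ∧ CyclicStep (F k) (F (k + 1)) (P k)) ∧
      ∀ i j, i < j → j < r → P i ≤ P j → P i = P j := by
  obtain ⟨r, F, P, ⟨h0, h1, hle, hF⟩, hP⟩ := h
  refine ⟨r, fun k => if h : k < r + 1 then F ⟨k, h⟩ else ⊤,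
    fun k => if h : k < r then P ⟨k, h⟩ else ⊤, by simpa using h0,
    (dif_pos r.lt_succ_self).trans h1,
    fun k hk => ?_, fun i j hij hj => ?_⟩
  · have := (CyclicStep.nonempty_map_mkQ_equiv_iff (hle ⟨k, hk⟩)).1 (hF ⟨k, hk⟩).2
    simpa [hk, hk.le, Nat.lt_succ_of_lt hk] using ⟨(hF ⟨k, hk⟩).1, this⟩
  · simpa [hj, hij.trans hj] using hP ⟨i, hij.trans hj⟩ ⟨j, hj⟩ hij.le

end Filtration

section DimensionFiltration

variable {R : Type*} [CommRing R]

lemma ringKrullDim_quotient_anti {p q : Ideal R} (h : p ≤ q) :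
    ringKrullDim (R ⧸ q) ≤ ringKrullDim (R ⧸ p) :=
  ringKrullDim_le_of_surjective (Ideal.Quotient.factor h) (Ideal.Quotient.factor_surjective h)

lemma ringKrullDim_quotient_succ_le_of_lt {p q : Ideal R} (hp : p.IsPrime) (h : p < q) :
    ringKrullDim (R ⧸ q) + 1 ≤ ringKrullDim (R ⧸ p) := by
  obtain ⟨x, hxq, hxp⟩ := SetLike.exists_of_lt h
  refine ringKrullDim_succ_le_of_surjective (Ideal.Quotient.factor h.le)
    (Ideal.Quotient.factor_surjective h.le) (r := Ideal.Quotient.mk p x) ?_ ?_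
  · rwa [mem_nonZeroDivisors_iff_ne_zero, ne_eq, Ideal.Quotient.eq_zero_iff_mem]
  · rwa [Ideal.Quotient.factor_mk, Ideal.Quotient.eq_zero_iff_mem]

lemma eq_of_le_of_ringKrullDim_quotient_eq {p q : Ideal R} {i : ℕ} (hp : p.IsPrime) (h : p ≤ q)
    (hpi : ringKrullDim (R ⧸ p) = i) (hqi : ringKrullDim (R ⧸ q) = i) : p = q := by
  by_contra hne
  have := ringKrullDim_quotient_succ_le_of_lt hp (lt_of_le_of_ne h hne)
  rw [hpi, hqi] at this
  exact absurd (by exact_mod_cast this : i + 1 ≤ i) (by omega)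

/-- `D i` consists of the elements whose class modulo `I` vanishes after localization at all
primes of dimension at least `i`. -/
def IsTorsionFiltration (I : Ideal R) (D : ℕ → Ideal R) : Prop :=
  ∀ i f, f ∈ D i ↔ ∀ p : Ideal R, p.IsPrime → (i : WithBot ℕ∞) ≤ ringKrullDim (R ⧸ p) →
    ∃ s ∉ p, s * f ∈ I

lemma isTorsionFiltration_of_primaryDecomposition [IsNoetherianRing R] {I : Ideal R}
    {Q : Ideal R → Ideal R}
    (hQ : ∀ p ∈ associatedPrimes R (R ⧸ I), (Q p).IsPrimary ∧ (Q p).radical = p)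
    (hdec : I = ⨅ p ∈ associatedPrimes R (R ⧸ I), Q p)
    {D : ℕ → Ideal R} (hD0 : D 0 = I)
    (hD : ∀ i : ℕ, D (i + 1) =
      ⨅ p ∈ {p | p ∈ associatedPrimes R (R ⧸ I) ∧
        (i : WithBot ℕ∞) < ringKrullDim (R ⧸ p)}, Q p) :
    IsTorsionFiltration I D := by
  have hI : ∀ f, f ∈ I ↔ ∀ p ∈ associatedPrimes R (R ⧸ I), f ∈ Q p := fun f => by
    conv_lhs => rw [hdec]
    simp only [Submodule.mem_iInf]
  have hmem : ∀ i f, f ∈ D i ↔ ∀ p ∈ associatedPrimes R (R ⧸ I),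
      (i : WithBot ℕ∞) ≤ ringKrullDim (R ⧸ p) → f ∈ Q p := by
    rintro (_ | i) f
    · rw [hD0, hI]
      refine forall₂_congr fun p hp => (imp_iff_right ?_).symm
      have := hp.1
      exact_mod_cast ringKrullDim_nonneg_of_nontrivial
    · simp only [hD, Submodule.mem_iInf, Set.mem_ofPred_eq, and_imp]
      refine forall₂_congr fun p hp => ?_
      rw [Nat.cast_succ, ENat.WithBot.add_one_le_iff]
  intro i f
  rw [hmem]
  constructor
  · intro hf p hp hip
    have hfin := associatedPrimes.finite R (R ⧸ I)
    have key : ∀ T : Finset (Ideal R), ↑T ⊆ associatedPrimes R (R ⧸ I) →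
        ∃ s ∉ p, ∀ q ∈ T, s * f ∈ Q q := by
      intro T
      classical
      induction T using Finset.induction_on with
      | empty => exact fun _ => ⟨1, fun h => hp.ne_top ((Ideal.eq_top_iff_one _).2 h), by simp⟩
      | insert q T _ ih =>
        intro hT
        rw [Finset.coe_insert, Set.insert_subset_iff] at hT
        obtain ⟨s, hs, hsT⟩ := ih hT.2
        by_cases hqp : q ≤ p
        · refine ⟨s, hs, fun q' hq' => ?_⟩
          rcases Finset.mem_insert.1 hq' with rfl | hq'
          · exact Ideal.mul_mem_left _ _ (hf _ hT.1 (hip.trans (ringKrullDim_quotient_anti hqp)))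
          · exact hsT _ hq'
        · obtain ⟨t, htq, htp⟩ := SetLike.not_le_iff_exists.1 hqp
          rw [← (hQ q hT.1).2] at htq
          obtain ⟨m, hm⟩ := htq
          refine ⟨t ^ m * s, fun h => (hp.mem_or_mem h).elim
            (fun h => htp (hp.mem_of_pow_mem _ h)) hs, fun q' hq' => ?_⟩
          rcases Finset.mem_insert.1 hq' with rfl | hq'
          · rw [mul_assoc]
            exact Ideal.mul_mem_right _ _ hm
          · rw [mul_assoc]
            exact Ideal.mul_mem_left _ _ (hsT _ hq')
    obtain ⟨s, hs, h⟩ := key hfin.toFinset (by simp)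
    exact ⟨s, hs, (hI _).2 fun q hq => h q (hfin.mem_toFinset.2 hq)⟩
  · intro h p hp hip
    obtain ⟨s, hs, hsf⟩ := h p hp.1 hip
    refine ((Ideal.isPrimary_iff.1 (hQ p hp).1).2
      (mul_comm s f ▸ (hI _).1 hsf p hp)).resolve_right ?_
    rwa [(hQ p hp).2]

lemma CyclicFiltration.of_map_mkQ {A B : Ideal R} (hAB : A ≤ B) {L : List (Ideal R)}
    (h : CyclicFiltration (⊥ : Submodule R ↥(Submodule.map A.mkQ B)) ⊤ L) :
    CyclicFiltration A B L := by
  have := (h.map (Submodule.map A.mkQ B).subtype (by simp)).comap A.mkQ (by simp)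
  rwa [Submodule.map_bot, Submodule.comap_bot, Submodule.ker_mkQ, Submodule.map_top,
    Submodule.range_subtype, Submodule.comap_map_eq, Submodule.ker_mkQ, sup_eq_left.2 hAB] at this

lemma CyclicFiltration.to_map_mkQ {A B : Ideal R} {L : List (Ideal R)}
    (h : CyclicFiltration A B L) :
    CyclicFiltration (⊥ : Submodule R ↥(Submodule.map A.mkQ B)) ⊤ L := by
  have := (h.map A.mkQ (by simp)).comap (Submodule.map A.mkQ B).subtype (by simp)
  rwa [Submodule.mkQ_map_self, Submodule.comap_bot, Submodule.ker_subtype,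
    Submodule.comap_subtype_self] at this

namespace IsTorsionFiltration

variable {I : Ideal R} {D : ℕ → Ideal R}

lemma mono (h : IsTorsionFiltration I D) {i j : ℕ} (hij : i ≤ j) : D i ≤ D j := fun f hf =>
  (h j f).2 fun p hp hj => (h i f).1 hf p hp (le_trans (by exact_mod_cast hij) hj)

lemma base_le (h : IsTorsionFiltration I D) (i : ℕ) : I ≤ D i := fun f hf =>
  (h i f).2 fun p hp _ =>
    ⟨1, fun h => hp.ne_top ((Ideal.eq_top_iff_one _).2 h), by rwa [one_mul]⟩

lemma mem_of_forall_mul_mem (h : IsTorsionFiltration I D) {i : ℕ} {P : Ideal R} {f : R}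
    (hP : ringKrullDim (R ⧸ P) < i) (hf : ∀ c ∈ P, c * f ∈ D i) : f ∈ D i := by
  refine (h i f).2 fun p hp hip => ?_
  have hle : ¬ P ≤ p := fun hle =>
    ((ringKrullDim_quotient_anti hle).trans_lt hP).not_ge hip
  obtain ⟨c, hcP, hcp⟩ := SetLike.not_le_iff_exists.1 hle
  obtain ⟨s, hs, hsf⟩ := (h i _).1 (hf c hcP) p hp hip
  refine ⟨s * c, fun hsc => (hp.mem_or_mem hsc).elim hs hcp, ?_⟩
  rwa [mul_assoc]

lemma ringKrullDim_eq_of_isAssociatedPrime [IsNoetherianRing R] (h : IsTorsionFiltration I D)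
    {i : ℕ} {P : Ideal R}
    (hP : IsAssociatedPrime P ↥(Submodule.map (D i).mkQ (D (i + 1)))) :
    ringKrullDim (R ⧸ P) = i := by
  obtain ⟨hprime, ⟨_, f, hf, rfl⟩, hPx⟩ := (isAssociatedPrime_iff ..).1 hP
  have hPf : ∀ c, c ∈ P ↔ c * f ∈ D i := fun c => by
    rw [hPx, Submodule.mem_colon_singleton, Submodule.mem_bot, ← Submodule.coe_eq_zero,
      Submodule.coe_smul, ← map_smul, Submodule.mkQ_apply, Submodule.Quotient.mk_eq_zero,
      smul_eq_mul]
  refine le_antisymm (not_lt.1 fun hlt => ?_) (not_lt.1 fun hlt => ?_)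
  · rw [← ENat.WithBot.add_one_le_iff] at hlt
    obtain ⟨s, hs, hsf⟩ := (h (i + 1) f).1 hf P hprime (by exact_mod_cast hlt)
    exact hs ((hPf s).2 (h.base_le i hsf))
  · have h1 := h.mem_of_forall_mul_mem hlt fun c hc => (hPf c).1 hc
    exact hprime.ne_top ((Ideal.eq_top_iff_one _).2 ((hPf 1).2 (by rwa [one_mul])))

lemma exists_cyclicFiltration_of_isCleanModule [IsNoetherianRing R] (h : IsTorsionFiltration I D)
    {m : ℕ} (hclean : ∀ i < m, Submodule.map (D i).mkQ (D (i + 1)) ≠ ⊥ →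
      IsCleanModule R ↥(Submodule.map (D i).mkQ (D (i + 1)))) (hD0 : D 0 = I) :
    ∃ L, CyclicFiltration I (D m) L ∧ (∀ P ∈ L, P.IsPrime ∧ ringKrullDim (R ⧸ P) < m) ∧
      L.Pairwise fun P Q => P ≤ Q → P = Q := by
  induction m with
  | zero => exact ⟨[], hD0 ▸ .refl _, by simp, by simp⟩
  | succ m ih =>
    obtain ⟨L, hL, hLP, hLL⟩ := ih fun i hi => hclean i (hi.trans m.lt_succ_self)
    have hlt : ((m : ℕ) : WithBot ℕ∞) < (m + 1 : ℕ) := by exact_mod_cast m.lt_succ_self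
    by_cases hbot : Submodule.map (D m).mkQ (D (m + 1)) = ⊥
    · rw [← le_bot_iff, Submodule.map_le_iff_le_comap, Submodule.comap_bot,
        Submodule.ker_mkQ] at hbot
      rw [le_antisymm hbot (h.mono m.le_succ)]
      exact ⟨L, hL, fun P hP => ⟨(hLP P hP).1, (hLP P hP).2.trans hlt⟩, hLL⟩
    · obtain ⟨L', hL', hLP'⟩ :=
        isCleanModule_iff_cyclicFiltration.1 (hclean m m.lt_succ_self hbot)
      have hdim : ∀ P ∈ L', ringKrullDim (R ⧸ P) = m := fun P hP =>
        h.ringKrullDim_eq_of_isAssociatedPrime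
          (Module.associatedPrimes.minimalPrimes_annihilator_subset_associatedPrimes _ _
            (hLP' P hP).2)
      refine ⟨L ++ L', hL.append (.of_map_mkQ (h.mono m.le_succ) hL'), fun P hP => ?_, ?_⟩
      · rcases List.mem_append.1 hP with hP | hP
        · exact ⟨(hLP P hP).1, (hLP P hP).2.trans hlt⟩
        · exact ⟨(hLP' P hP).1, (hdim P hP).trans_lt hlt⟩
      · refine List.pairwise_append.2 ⟨hLL, ?_, fun P hP P' hP' hle => ?_⟩
        · exact List.pairwise_of_forall_mem_list fun P hP P' hP' hle =>
            eq_of_le_of_ringKrullDim_quotient_eq (hLP' P hP).1 hle (hdim P hP) (hdim P' hP')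
        · exact absurd (ringKrullDim_quotient_anti hle)
            (by rw [hdim P' hP']; exact (hLP P hP).2.not_ge)

lemma isPrettyClean_of_isCleanModule [IsDomain R] [IsNoetherianRing R]
    (h : IsTorsionFiltration I D) {m : ℕ} (hm : ringKrullDim R = m)
    (hclean : ∀ i < m, Submodule.map (D i).mkQ (D (i + 1)) ≠ ⊥ →
      IsCleanModule R ↥(Submodule.map (D i).mkQ (D (i + 1)))) (hD0 : D 0 = I) :
    IsPrettyClean I := by
  by_cases hI : I = ⊥
  · subst hI
    have hstep : CyclicStep (⊥ : Ideal R) ⊤ ⊥ := ⟨1, by simp [Ideal.span_singleton_one],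
      fun c => by simp⟩
    exact isPrettyClean_of_cyclicFiltration (L := [⊥]) (.cons hstep (.refl ⊤))
      (by simpa using Ideal.isPrime_bot) (by simp)
  · have htop : D m = ⊤ := by
      refine (Ideal.eq_top_iff_one _).2 ((h m 1).2 fun p hp hmp => ?_)
      have hp0 : p = ⊥ := by
        by_contra hp0
        have := ringKrullDim_quotient_succ_le_of_lt Ideal.isPrime_bot (bot_lt_iff_ne_bot.2 hp0)
        rw [ringKrullDim_eq_of_ringEquiv (RingEquiv.quotientBot R), hm] at this
        have h1 := (add_le_add_left hmp 1).trans this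
        exact absurd (by exact_mod_cast h1 : m + 1 ≤ m) (by omega)
      obtain ⟨s, hs, hs0⟩ := Submodule.exists_mem_ne_zero_of_ne_bot hI
      exact ⟨s, by simpa [hp0] using hs0, by rwa [mul_one]⟩
    obtain ⟨L, hL, hLP, hLL⟩ := h.exists_cyclicFiltration_of_isCleanModule hclean hD0
    exact isPrettyClean_of_cyclicFiltration (htop ▸ hL) (fun P hP => (hLP P hP).1) hLL

end IsTorsionFiltration

end DimensionFiltration

section VariableIdeal

/-- The ideal generated by the variables with index in `A`. -/
noncomputable def variableIdeal (K : Type*) [Field K] {n : ℕ} (A : Finset (Fin n)) :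
    Ideal (MvPolynomial (Fin n) K) :=
  Ideal.span (X '' (A : Set (Fin n)))

lemma mem_variableIdeal {A : Finset (Fin n)} {f : Sn} :
    f ∈ variableIdeal K A ↔ ∀ m ∈ f.support, ∃ i ∈ A, m i ≠ 0 :=
  mem_ideal_span_X_image

lemma X_mem_variableIdeal {A : Finset (Fin n)} {i : Fin n} :
    (X i : Sn) ∈ variableIdeal K A ↔ i ∈ A := by
  classical
  simp [mem_variableIdeal, X, support_monomial, Finsupp.single_apply]

lemma variableIdeal_le_iff {A B : Finset (Fin n)} :
    variableIdeal K A ≤ variableIdeal K B ↔ A ⊆ B := by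
  refine ⟨fun h i hi => X_mem_variableIdeal.1 (h (X_mem_variableIdeal.2 hi)), fun h => ?_⟩
  exact Ideal.span_mono (Set.image_mono (Finset.coe_subset.2 h))

lemma variableIdeal_le_irrelevant (A : Finset (Fin n)) : variableIdeal K A ≤ mn :=
  Ideal.span_mono (Set.image_subset_range _ _)

lemma killCompl_eq_zero_iff {d : ℕ} {A : Finset (Fin n)} (f : Fin d → Fin n)
    (hf : Function.Injective f) (hrange : ∀ i, i ∈ Set.range f ↔ i ∉ A) (p : Sn) :
    killCompl hf p = 0 ↔ p ∈ variableIdeal K A := by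
  rw [mem_variableIdeal]
  constructor
  · intro h m hm
    by_contra! H
    have hsub : (m.support : Set (Fin n)) ⊆ Set.range f := fun i hi => by
      rw [hrange]
      exact fun hiA => Finsupp.mem_support_iff.1 hi (H i hiA)
    have := coeff_killCompl hf (p := p) (s := m.comapDomain f hf.injOn)
    rw [h, Finsupp.mapDomain_comapDomain _ hf _ hsub, coeff_zero] at this
    exact mem_support_iff.1 hm this.symm
  · intro h
    ext s
    rw [coeff_killCompl, coeff_zero]
    by_contra H
    obtain ⟨i, hiA, hi⟩ := h _ (mem_support_iff.2 H)
    exact hi (Finsupp.mapDomain_of_notMem_range _ _ fun hr => (hrange i).1 hr hiA)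

/-- Setting the variables in `A` to zero and renumbering the others. -/
noncomputable def eraseVariables (K : Type*) [Field K] {n d : ℕ} (A : Finset (Fin n))
    (h : Aᶜ.card = d) : MvPolynomial (Fin n) K →ₐ[K] MvPolynomial (Fin d) K :=
  killCompl (Aᶜ.orderEmbOfFin h).injective

variable {d : ℕ} {A : Finset (Fin n)}

lemma eraseVariables_surjective (h : Aᶜ.card = d) :
    Function.Surjective (eraseVariables K A h) := fun p =>
  ⟨rename (Aᶜ.orderEmbOfFin h) p, killCompl_rename_app _ p⟩

lemma eraseVariables_eq_zero_iff (h : Aᶜ.card = d) (p : Sn) :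
    eraseVariables K A h p = 0 ↔ p ∈ variableIdeal K A :=
  killCompl_eq_zero_iff _ _ (fun i => by simp [Finset.range_orderEmbOfFin]) p

lemma ker_eraseVariables (h : Aᶜ.card = d) :
    RingHom.ker (eraseVariables K A h).toRingHom = variableIdeal K A := by
  ext p
  exact eraseVariables_eq_zero_iff h p

lemma variableIdeal_isPrime (A : Finset (Fin n)) : (variableIdeal K A).IsPrime := by
  rw [← ker_eraseVariables rfl]
  exact RingHom.ker_isPrime _

lemma ringKrullDim_quotient_variableIdeal (h : Aᶜ.card = d) :
    ringKrullDim (Sn ⧸ variableIdeal K A) = d := by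
  rw [← ker_eraseVariables h, ringKrullDim_eq_of_ringEquiv
    (RingHom.quotientKerEquivOfSurjective (eraseVariables_surjective h)),
    MvPolynomial.ringKrullDim_of_isNoetherianRing, ringKrullDim_eq_zero_of_field]
  simp

lemma monomial_mem_of_isPrime {P : Ideal Sn} (hP : P.IsPrime) {u : Fin n →₀ ℕ}
    (h : (monomial u 1 : Sn) ∈ P) : ∃ i, u i ≠ 0 ∧ (X i : Sn) ∈ P := by
  rw [monomial_eq, C_1, one_mul, Finsupp.prod, hP.prod_mem_iff] at h
  obtain ⟨i, hi, h⟩ := h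
  exact ⟨i, Finsupp.mem_support_iff.1 hi, hP.mem_of_pow_mem _ h⟩

lemma card_support_sub_monomial_lt {f : Sn} {u : Fin n →₀ ℕ} (hu : u ∈ f.support) :
    (f - monomial u (f.coeff u)).support.card < f.support.card := by
  classical
  refine (Finset.card_le_card (t := f.support.erase u) fun v hv => ?_).trans_lt
    (Finset.card_erase_lt_of_mem hu)
  rw [mem_support_iff, coeff_sub, coeff_monomial] at hv
  by_cases huv : u = v
  · simp [huv] at hv
  · simpa [huv, Ne.symm huv] using hv

lemma IsMonomialIdeal.monomial_mem {I : Ideal Sn} (hI : IsMonomialIdeal I) {f : Sn} (hf : f ∈ I)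
    {u : Fin n →₀ ℕ} (hu : u ∈ f.support) (c : K) : monomial u c ∈ I := by
  obtain ⟨G, hG, rfl⟩ := hI
  have hG' : G = (fun e => monomial e (1 : K)) '' {e | monomial e (1 : K) ∈ G} := by
    ext g
    constructor
    · intro hg
      obtain ⟨e, rfl⟩ := hG g hg
      exact ⟨e, hg, rfl⟩
    · rintro ⟨e, he, rfl⟩
      exact he
  rw [hG', mem_ideal_span_monomial_image] at hf ⊢
  classical
  intro v hv
  rw [Finset.mem_singleton.1 (support_monomial_subset hv)]
  exact hf u hu

/-- A prime ideal that is the annihilator of an element modulo a monomial ideal is generated by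
variables. -/
lemma IsMonomialIdeal.exists_eq_variableIdeal {I : Ideal Sn} (hI : IsMonomialIdeal I)
    {P : Ideal Sn} (hP : P.IsPrime) (h : ∃ f, ∀ c, c * f ∈ I ↔ c ∈ P) :
    ∃ A, P = variableIdeal K A := by
  classical
  obtain ⟨f, hf, hfmin⟩ := (measure fun f : Sn => f.support.card).wf.has_min
    {f | ∀ c, c * f ∈ I ↔ c ∈ P} h
  let A : Finset (Fin n) := {i | (X i : Sn) ∈ P}
  have hAP : variableIdeal K A ≤ P := by
    rw [variableIdeal, Ideal.span_le]
    rintro _ ⟨i, hi, rfl⟩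
    simpa [A] using hi
  refine ⟨A, le_antisymm ?_ hAP⟩
  by_contra hle
  obtain ⟨g, ⟨hgP, hgA⟩, hgmin⟩ := (measure fun f : Sn => f.support.card).wf.has_min
    {g | g ∈ P ∧ g ∉ variableIdeal K A} (SetLike.not_le_iff_exists.1 hle)
  let o : MonomialOrder (Fin n) := MonomialOrder.lex
  have hg0 : g ≠ 0 := fun h => hgA (h ▸ zero_mem _)
  have hf0 : f ≠ 0 := fun h => hP.ne_top ((Ideal.eq_top_iff_one _).2
    ((hf 1).1 (by simp [h])))
  set u := o.degree g
  set v := o.degree f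
  have hu : u ∈ g.support := o.degree_mem_support hg0
  have hv : v ∈ f.support := o.degree_mem_support hf0
  have huP : (monomial u 1 : Sn) ∉ P := by
    intro h
    obtain ⟨i, hi, hiP⟩ := monomial_mem_of_isPrime hP h
    have huA : monomial u (g.coeff u) ∈ variableIdeal K A := mem_variableIdeal.2 fun w hw => by
      rw [Finset.mem_singleton.1 (support_monomial_subset hw)]
      exact ⟨i, by simpa [A] using hiP, hi⟩
    exact hgmin (g - monomial u (g.coeff u)) ⟨P.sub_mem hgP (hAP huA), fun h =>
      hgA ((Submodule.sub_mem_iff_left _ huA).1 h)⟩ (card_support_sub_monomial_lt hu)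
  have huv : u + v ∈ (g * f).support := by
    rw [mem_support_iff, o.coeff_mul_of_degree_add]
    exact mul_ne_zero (o.leadingCoeff_ne_zero_iff.2 hg0) (o.leadingCoeff_ne_zero_iff.2 hf0)
  have hI' := hI.monomial_mem ((hf g).2 hgP) huv (f.coeff v)
  refine hfmin (monomial u 1 * (f - monomial v (f.coeff v))) (fun c => ?_) ?_
  · rw [mul_sub, monomial_mul, one_mul, mul_sub,
      Submodule.sub_mem_iff_left _ (I.mul_mem_left _ hI'), ← mul_assoc, hf,
      hP.mul_mem_iff_mem_or_mem,
      or_iff_left huP]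
  · refine lt_of_le_of_lt ?_ (card_support_sub_monomial_lt hv)
    refine (Finset.card_le_card (support_mul _ _)).trans (Finset.card_add_le.trans ?_)
    refine (Nat.mul_le_mul_right _ ((Finset.card_le_card support_monomial_subset).trans
      (Finset.card_singleton u).le)).trans (one_mul _).le

end VariableIdeal

section PrettyClean

lemma mem_variableIdeal_insert {A : Finset (Fin n)} {a : Fin n} {f : Sn} :
    f ∈ variableIdeal K (insert a A) ↔ ∃ c, ∃ p ∈ variableIdeal K A, f = c * X a + p := by
  rw [variableIdeal, Finset.coe_insert, Set.image_insert_eq, Ideal.mem_span_insert]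
  rfl

/-- The data of a pretty clean filtration, indexed by natural numbers below `r`. -/
structure PrettyCleanChain {R : Type*} [CommRing R] (r : ℕ) (F P : ℕ → Ideal R) : Prop where
  isPrime : ∀ k < r, (P k).IsPrime
  step : ∀ k < r, CyclicStep (F k) (F (k + 1)) (P k)
  eq_of_le : ∀ i j, i < j → j < r → P i ≤ P j → P i = P j

namespace PrettyCleanChain

section General

variable {R : Type*} [CommRing R] {r : ℕ} {F P : ℕ → Ideal R}

lemma mono (h : PrettyCleanChain r F P) {i j : ℕ} (hij : i ≤ j) (hj : j ≤ r) : F i ≤ F j := by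
  induction j, hij using Nat.le_induction with
  | base => exact le_rfl
  | succ k _ ih => exact (ih (by omega)).trans (h.step k (by omega)).le

lemma cyclicFiltration (h : PrettyCleanChain r F P) {j : ℕ} (hj : j ≤ r) :
    ∃ L, CyclicFiltration (F 0) (F j) L ∧ ∀ p ∈ L, ∃ k < j, P k = p := by
  induction j with
  | zero => exact ⟨[], .refl _, by simp⟩
  | succ j ih =>
    obtain ⟨L, hL, hLP⟩ := ih (by omega)
    refine ⟨L ++ [P j], hL.concat (h.step j hj), fun p hp => ?_⟩
    rcases List.mem_append.1 hp with hp | hp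
    · obtain ⟨k, hk, rfl⟩ := hLP p hp
      exact ⟨k, by omega, rfl⟩
    · exact ⟨j, by omega, (List.mem_singleton.1 hp).symm⟩

lemma exists_colon [IsNoetherianRing R] (h : PrettyCleanChain r F P) {j : ℕ} (hj : j < r) :
    ∃ f, ∀ c, c * f ∈ F 0 ↔ c ∈ P j := by
  obtain ⟨g, hg, hgP⟩ := h.step j hj
  have hmin : P j ∈ ((F 0).colon {g}).minimalPrimes := by
    refine ⟨⟨h.isPrime j hj, fun c hc => ?_⟩, fun q ⟨hq, hqg⟩ hqP => ?_⟩
    · rw [Submodule.mem_colon_singleton] at hc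
      exact (hgP c).1 (h.mono (Nat.zero_le j) hj.le hc)
    · obtain ⟨L, hL, hLP⟩ := h.cyclicFiltration (j := j + 1) hj
      obtain ⟨p, hp, hpq⟩ : ∃ p ∈ L, p ≤ q := by
        by_contra! H
        obtain ⟨s, hs, hsF⟩ := hL.exists_notMem_smul_mem hq H
        refine hs (hqg (Submodule.mem_colon_singleton.2 (hsF g ?_)))
        rw [hg]
        exact Submodule.mem_sup_right (Submodule.mem_span_singleton_self g)
      obtain ⟨k, hk, rfl⟩ := hLP p hp
      rcases (Nat.lt_succ_iff.1 hk).eq_or_lt with rfl | hk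
      · exact hpq
      · exact (h.eq_of_le k j hk hj (hpq.trans hqP)).symm.le.trans hpq
  obtain ⟨f, hf⟩ := Submodule.exists_eq_colon_of_mem_minimalPrimes hmin
  exact ⟨f, fun c => by rw [hf, Submodule.mem_colon_singleton, smul_eq_mul]⟩

variable {D : ℕ → Ideal R}

lemma inf_le (h : PrettyCleanChain r F P) (hD : IsTorsionFiltration (F 0) D) {i k : ℕ}
    (hk : k < r) (hi : (i : WithBot ℕ∞) ≤ ringKrullDim (R ⧸ P k)) : F (k + 1) ⊓ D i ≤ F k := by
  rintro x ⟨hx, hxD⟩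
  obtain ⟨s, hs, hsx⟩ := (hD i x).1 hxD (P k) (h.isPrime k hk) hi
  obtain ⟨g, hg, hgP⟩ := h.step k hk
  rw [SetLike.mem_coe, hg] at hx
  obtain ⟨y, hy, z, hz, rfl⟩ := Submodule.mem_sup.1 hx
  obtain ⟨c, rfl⟩ := Submodule.mem_span_singleton.1 hz
  have hsF := h.mono (Nat.zero_le k) hk.le hsx
  rw [mul_add, Submodule.add_mem_iff_right _ ((F k).mul_mem_left s hy), ← smul_eq_mul s, smul_smul,
    hgP] at hsF
  exact (F k).add_mem hy ((hgP c).2 (((h.isPrime k hk).mem_or_mem hsF).resolve_left hs))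

lemma inf_sup_le (h : PrettyCleanChain r F P) (hD : IsTorsionFiltration (F 0) D) {i k : ℕ}
    (hk : k < r) (hi : (i : WithBot ℕ∞) ≤ ringKrullDim (R ⧸ P k)) :
    F (k + 1) ⊓ (F k ⊔ D i) ≤ F k := by
  rw [inf_comm, sup_inf_assoc_of_le _ (h.step k hk).le, inf_comm (D i)]
  exact sup_le le_rfl (h.inf_le hD hk hi)

end General

variable {r : ℕ} {F P D : ℕ → Ideal (MvPolynomial (Fin n) K)} {A : ℕ → Finset (Fin n)}

lemma exists_eq_variableIdeal (h : PrettyCleanChain r F P) (hI : IsMonomialIdeal (F 0)) :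
    ∃ A : ℕ → Finset (Fin n), ∀ k < r, P k = variableIdeal K (A k) := by
  have H : ∀ k, ∃ A : Finset (Fin n), k < r → P k = variableIdeal K A := fun k => by
    by_cases hk : k < r
    · obtain ⟨A, hA⟩ := hI.exists_eq_variableIdeal (h.isPrime k hk) (h.exists_colon hk)
      exact ⟨A, fun _ => hA⟩
    · exact ⟨∅, fun h => absurd h hk⟩
  choose A hA using H
  exact ⟨A, hA⟩

lemma le_sup (h : PrettyCleanChain r F P) (hA : ∀ k < r, P k = variableIdeal K (A k))
    (hD : IsTorsionFiltration (F 0) D) {i j : ℕ} (hj : j < r) (hi : (A j)ᶜ.card < i) :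
    F (j + 1) ≤ F j ⊔ D i := by
  classical
  induction j using Nat.strong_induction_on with
  | _ j ih =>
  obtain ⟨f, hf, hfP⟩ := h.step j hj
  have key : ∀ k ≤ j, ∃ y ∈ F j, ∀ p ∈ P j, p * (f - y) ∈ F k ⊔ D i := by
    intro k hk
    induction hk using Nat.decreasingInduction with
    | self =>
      exact ⟨0, zero_mem _, fun p hp => by
        rw [sub_zero]
        exact Submodule.mem_sup_left ((hfP p).2 hp)⟩
    | of_succ k hkj ih' =>
      obtain ⟨y, hy, hyp⟩ := ih'
      by_cases hki : (A k)ᶜ.card < i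
      · exact ⟨y, hy, fun p hp => sup_le (ih k hkj (by omega) hki) le_sup_right (hyp p hp)⟩
      have hkr : k < r := by omega
      obtain ⟨g, hg, hgP⟩ := h.step k hkr
      have hgF : g ∈ F (k + 1) := by
        rw [hg]
        exact Submodule.mem_sup_right (Submodule.mem_span_singleton_self g)
      have hgN : ∀ c, c * g ∈ F k ⊔ D i ↔ c ∈ P k := fun c => by
        refine ⟨fun hc => (hgP c).1 (h.inf_sup_le (i := i) hD hkr ?_
          ⟨Ideal.mul_mem_left _ _ hgF, hc⟩), fun hc => Submodule.mem_sup_left ((hgP c).2 hc)⟩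
        rw [hA k hkr, ringKrullDim_quotient_variableIdeal rfl]
        exact_mod_cast not_lt.1 hki
      have hrep : ∀ p ∈ P j, ∃ c, p * (f - y) - c * g ∈ F k ⊔ D i := fun p hp => by
        have := hyp p hp
        rw [hg, sup_right_comm] at this
        obtain ⟨x, hx, z, hz, hxz⟩ := Submodule.mem_sup.1 this
        obtain ⟨c, rfl⟩ := Submodule.mem_span_singleton.1 hz
        exact ⟨c, by rwa [← hxz, smul_eq_mul, add_sub_cancel_right]⟩
      have hcard : 1 < (A j \ A k).card := by
        have h1 := Finset.card_compl_add_card (A j)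
        have h2 := Finset.card_compl_add_card (A k)
        have h3 := Finset.card_sdiff_add_card_inter (A j) (A k)
        have h4 : A j ∩ A k ⊂ A k := by
          refine Finset.ssubset_iff_subset_ne.2 ⟨Finset.inter_subset_right, fun heq => ?_⟩
          have hle : P k ≤ P j := by
            rw [hA k hkr, hA j hj, variableIdeal_le_iff]
            exact Finset.inter_eq_right.1 heq
          have := h.eq_of_le k j hkj hj hle
          rw [hA k hkr, hA j hj] at this
          rw [(variableIdeal_le_iff.1 this.le).antisymm (variableIdeal_le_iff.1 this.ge)] at hki
          exact hki hi
        have h5 := Finset.card_lt_card h4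
        omega
      obtain ⟨a, ha, b, hb, hab⟩ := Finset.one_lt_card.1 hcard
      rw [Finset.mem_sdiff] at ha hb
      obtain ⟨α, hα⟩ := hrep (X a) (by rw [hA j hj]; exact X_mem_variableIdeal.2 ha.1)
      obtain ⟨β, hβ⟩ := hrep (X b) (by rw [hA j hj]; exact X_mem_variableIdeal.2 hb.1)
      have hαβ : X b * α - X a * β ∈ P k := by
        rw [← hgN]
        have := Submodule.sub_mem _ (Ideal.mul_mem_left _ (X a) hβ) (Ideal.mul_mem_left _ (X b) hα)
        convert this using 1
        ring
      have hα' : α ∈ variableIdeal K (insert a (A k)) := by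
        refine ((variableIdeal_isPrime (K := K) (insert a (A k))).mem_or_mem (x := X b) (y := α)
          (mem_variableIdeal_insert.2 ⟨β, _, hA k hkr ▸ hαβ, by ring⟩)).resolve_left ?_
        rw [X_mem_variableIdeal, Finset.mem_insert]
        exact fun h => h.elim (fun h => hab h.symm) hb.2
      obtain ⟨c, p', hp', hαc⟩ := mem_variableIdeal_insert.1 hα'
      rw [← hA k hkr] at hp'
      refine ⟨y + c * g, add_mem hy (Ideal.mul_mem_left _ _ (h.mono hkj hj.le hgF)),
        fun p hp => ?_⟩
      obtain ⟨γ, hγ⟩ := hrep p hp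
      have hγc : γ - p * c ∈ P k := by
        refine ((h.isPrime k hkr).mem_or_mem (x := X a) ?_).resolve_left ?_
        · have h1 := Submodule.sub_mem _ (Ideal.mul_mem_left _ p hα)
            (Ideal.mul_mem_left _ (X a) hγ)
          have h2 : (X a * γ - p * α) * g ∈ F k ⊔ D i := by
            convert h1 using 1
            ring
          have h3 := (P k).add_mem ((hgN _).1 h2) ((P k).mul_mem_left p hp')
          convert h3 using 1
          rw [hαc]
          ring
        · rw [hA k hkr, X_mem_variableIdeal]
          exact ha.2
      have := Submodule.add_mem _ hγ ((hgN _).2 hγc)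
      convert this using 1
      ring
  obtain ⟨y, hy, hyp⟩ := key 0 (Nat.zero_le j)
  have hfy : f - y ∈ D i := by
    refine hD.mem_of_forall_mul_mem (P := P j) ?_ fun c hc =>
      sup_le (hD.base_le i) le_rfl (hyp c hc)
    rw [hA j hj, ringKrullDim_quotient_variableIdeal rfl]
    exact_mod_cast hi
  rw [hf]
  refine sup_le le_sup_left ((Ideal.span_singleton_le_iff_mem _).2 ?_)
  rw [← add_sub_cancel y f]
  exact add_mem (Submodule.mem_sup_left hy) (Submodule.mem_sup_right hfy)

lemma exists_cyclicFiltration_factor (h : PrettyCleanChain r F P)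
    (hA : ∀ k < r, P k = variableIdeal K (A k)) (hD : IsTorsionFiltration (F 0) D) (i : ℕ)
    {k : ℕ} (hk : k ≤ r) :
    ∃ L, CyclicFiltration (D i) (F k ⊓ D (i + 1) ⊔ D i) L ∧
      ∀ p ∈ L, ∃ A : Finset (Fin n), p = variableIdeal K A ∧ Aᶜ.card = i := by
  have hDi : D i ≤ D (i + 1) := hD.mono i.le_succ
  induction k with
  | zero =>
    rw [inf_eq_left.2 (hD.base_le _), sup_eq_right.2 (hD.base_le _)]
    exact ⟨[], .refl _, by simp⟩
  | succ k ih =>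
    obtain ⟨L, hL, hLA⟩ := ih (by omega)
    have hdim : ringKrullDim (Sn ⧸ P k) = (A k)ᶜ.card := by
      rw [hA k hk, ringKrullDim_quotient_variableIdeal rfl]
    have hle := (h.step k hk).le
    rcases lt_trichotomy (A k)ᶜ.card i with hlt | heq | hgt
    · suffices F (k + 1) ⊓ D (i + 1) ⊔ D i = F k ⊓ D (i + 1) ⊔ D i from this ▸ ⟨L, hL, hLA⟩
      refine le_antisymm (sup_le ?_ le_sup_right) (sup_le_sup_right (inf_le_inf_right _ hle) _)
      refine (inf_le_inf_right _ (h.le_sup hA hD hk hlt)).trans ?_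
      rw [sup_comm, sup_inf_assoc_of_le _ hDi, sup_comm]
    · refine ⟨L ++ [P k], hL.concat ?_, fun p hp => ?_⟩
      · obtain ⟨f, hf, hfP⟩ := h.step k hk
        obtain ⟨y, hy, d, hd, hyd⟩ := Submodule.mem_sup.1
          (h.le_sup hA hD hk (heq.trans_lt i.lt_succ_self)
          (hf ▸ Submodule.mem_sup_right (Submodule.mem_span_singleton_self f) : f ∈ F (k + 1)))
        have hdF : ∀ c, c * d ∈ F k ↔ c ∈ P k := fun c => by
          rw [← hfP, ← hyd, smul_eq_mul, mul_add,
            Submodule.add_mem_iff_right _ ((F k).mul_mem_left c hy)]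
        have hF : F (k + 1) = F k ⊔ Ideal.span {d} := by
          rw [hf, ← hyd]
          refine le_antisymm (sup_le le_sup_left ((Ideal.span_singleton_le_iff_mem _).2 ?_))
            (sup_le le_sup_left ((Ideal.span_singleton_le_iff_mem _).2 ?_))
          · exact add_mem (Submodule.mem_sup_left hy)
              (Submodule.mem_sup_right (Ideal.mem_span_singleton_self d))
          · have hs := sub_mem (Submodule.mem_sup_right (Submodule.mem_span_singleton_self (y + d)))
              (Submodule.mem_sup_left hy : y ∈ F k ⊔ Submodule.span Sn {y + d})
            rwa [add_sub_cancel_left] at hs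
        have hdF' : d ∈ F (k + 1) :=
          hF ▸ Submodule.mem_sup_right (Ideal.mem_span_singleton_self d)
        have hGF : F k ⊓ D (i + 1) ⊔ D i ≤ F k ⊔ D i := sup_le_sup_right inf_le_left _
        refine ⟨d, ?_, fun c => ⟨fun hc => (hdF c).1 (h.inf_sup_le (i := i) hD hk ?_
          ⟨Ideal.mul_mem_left _ c hdF', hGF hc⟩), fun hc =>
          Submodule.mem_sup_left ⟨(hdF c).2 hc, Ideal.mul_mem_left _ _ hd⟩⟩⟩
        · rw [hF, sup_comm (F k), sup_inf_assoc_of_le _ ((Ideal.span_singleton_le_iff_mem _).2 hd),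
            sup_comm, sup_comm (Ideal.span {d}), ← sup_assoc, sup_comm (D i)]
        · rw [hdim, heq]
      · rcases List.mem_append.1 hp with hp | hp
        · exact hLA p hp
        · exact ⟨A k, (List.mem_singleton.1 hp).trans (hA k hk), heq⟩
    · suffices F (k + 1) ⊓ D (i + 1) = F k ⊓ D (i + 1) from this ▸ ⟨L, hL, hLA⟩
      refine le_antisymm (le_inf (h.inf_le hD hk ?_) inf_le_right) (inf_le_inf_right _ hle)
      rw [hdim]
      exact_mod_cast hgt

end PrettyCleanChain

/-- If all primes in a filtration of `M` are generated by the same number of variables, then they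
are minimal over the annihilator. -/
lemma CyclicFiltration.mem_minimalPrimes {M : Type*} [AddCommGroup M] [Module Sn M]
    {L : List (Ideal Sn)} (h : CyclicFiltration (⊥ : Submodule Sn M) ⊤ L) {i : ℕ}
    (hL : ∀ P ∈ L, ∃ A : Finset (Fin n), P = variableIdeal K A ∧ Aᶜ.card = i) :
    ∀ P ∈ L, P.IsPrime ∧ P ∈ (Module.annihilator Sn M).minimalPrimes := by
  have hL' : ∀ P ∈ L, P.IsPrime ∧ ringKrullDim (Sn ⧸ P) = i := fun P hP => by
    obtain ⟨A, rfl, hA⟩ := hL P hP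
    exact ⟨variableIdeal_isPrime A, ringKrullDim_quotient_variableIdeal hA⟩
  refine fun P hP => ⟨(hL' P hP).1, ⟨(hL' P hP).1, h.annihilator_le hP⟩, fun q ⟨hq, hqa⟩ hqP => ?_⟩
  obtain ⟨P', hP', hle⟩ := h.exists_le_of_annihilator_le hq hqa
  rwa [← eq_of_le_of_ringKrullDim_quotient_eq (hL' P' hP').1 (hle.trans hqP) (hL' P' hP').2
    (hL' P hP).2]

lemma IsPrettyClean.exists_cyclicFiltration_factor {I : Ideal Sn} (h : IsPrettyClean I)
    (hI : IsMonomialIdeal I) {D : ℕ → Ideal Sn} (hD : IsTorsionFiltration I D) (i : ℕ) :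
    ∃ L, CyclicFiltration (⊥ : Submodule Sn ↥(Submodule.map (D i).mkQ (D (i + 1)))) ⊤ L ∧
      ∀ p ∈ L, ∃ A : Finset (Fin n), p = variableIdeal K A ∧ Aᶜ.card = i := by
  obtain ⟨r, F, P, rfl, hr, hstep, hle⟩ := h.exists_nat
  have hc : PrettyCleanChain r F P := ⟨fun k hk => (hstep k hk).1, fun k hk => (hstep k hk).2, hle⟩
  obtain ⟨A, hA⟩ := hc.exists_eq_variableIdeal hI
  obtain ⟨L, hL, hLA⟩ := hc.exists_cyclicFiltration_factor hA hD i le_rfl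
  rw [hr, top_inf_eq, sup_eq_left.2 (hD.mono i.le_succ)] at hL
  exact ⟨L, hL.to_map_mkQ, hLA⟩

end PrettyClean

section CohenMacaulay

open CategoryTheory Abelian RingTheory.Sequence Pointwise

universe u

section General

variable {R : Type u} [CommRing R]

lemma subsingleton_ext_of_exact {M₁ M₂ M₃ : Type u}
    [AddCommGroup M₁] [Module R M₁] [AddCommGroup M₂] [Module R M₂] [AddCommGroup M₃] [Module R M₃]
    (N : ModuleCat.{u} R) (f : M₁ →ₗ[R] M₂) (g : M₂ →ₗ[R] M₃) (hf : Function.Injective f)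
    (hfg : Function.Exact f g) (hg : Function.Surjective g) (j : ℕ)
    (h₁ : Subsingleton (Ext N (ModuleCat.of R M₁) j))
    (h₃ : Subsingleton (Ext N (ModuleCat.of R M₃) j)) :
    Subsingleton (Ext N (ModuleCat.of R M₂) j) := by
  let T : ShortComplex (ModuleCat.{u} R) :=
    ShortComplex.mk (ModuleCat.ofHom f) (ModuleCat.ofHom g) (by
      ext x
      exact hfg.apply_apply_eq_zero x)
  have hT : T.ShortExact :=
    { exact := ModuleCat.shortComplex_exact T hfg
      mono_f := (ModuleCat.mono_iff_injective _).2 hf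
      epi_g := (ModuleCat.epi_iff_surjective _).2 hg }
  have hzero (x : Ext N (ModuleCat.of R M₂) j) : x = 0 := by
    obtain ⟨y, hy⟩ := Ext.covariant_sequence_exact₂ N hT x (h₃.elim _ _)
    rw [← hy, h₁.elim y 0, Ext.zero_comp]
  exact ⟨fun x y => (hzero x).trans (hzero y).symm⟩

lemma CyclicFiltration.subsingleton_ext {M : Type u} [AddCommGroup M] [Module R M]
    {A B : Submodule R M} {L : List (Ideal R)} (h : CyclicFiltration A B L) (hB : B = ⊤)
    (N : ModuleCat.{u} R) (j : ℕ)
    (hL : ∀ P ∈ L, Subsingleton (Ext N (ModuleCat.of R (R ⧸ P)) j)) :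
    Subsingleton (Ext N (ModuleCat.of R (M ⧸ A)) j) := by
  induction h with
  | refl A =>
    have : Subsingleton (M ⧸ A) := Submodule.Quotient.subsingleton_iff.2 hB
    have hid : 𝟙 (ModuleCat.of R (M ⧸ A)) = 0 :=
      (ModuleCat.isZero_of_iff_subsingleton.2 this).eq_zero_of_src _
    have hzero (x : Ext N (ModuleCat.of R (M ⧸ A)) j) : x = 0 := by
      rw [← Ext.comp_mk₀_id x, hid, Ext.mk₀_zero, Ext.comp_zero]
    exact ⟨fun x y => (hzero x).trans (hzero y).symm⟩
  | @cons A B C P L hAB _ ih =>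
    obtain ⟨e⟩ := (CyclicStep.nonempty_map_mkQ_equiv_iff hAB.le).2 hAB
    refine subsingleton_ext_of_exact N ((B.map A.mkQ).subtype ∘ₗ e.symm.toLinearMap)
      (Submodule.factor hAB.le) ?_ ?_ (Submodule.factor_surjective hAB.le) j
      (hL P List.mem_cons_self) (ih hB fun P hP => hL P (List.mem_cons_of_mem _ hP))
    · exact (Submodule.injective_subtype _).comp e.symm.injective
    · rw [LinearMap.exact_iff, LinearMap.range_comp, LinearEquiv.range, Submodule.map_top,
        Submodule.range_subtype, Submodule.factor, Submodule.mapQ, Submodule.ker_liftQ,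
        LinearMap.comp_id, Submodule.ker_mkQ]

lemma smul_top_lt_top_of_annihilator_le {M : Type*} [AddCommGroup M] [Module R M]
    [Module.Finite R M] {I : Ideal R} (hI : I ≠ ⊤) (hM : Module.annihilator R M ≤ I) :
    I • (⊤ : Submodule R M) < ⊤ := by
  refine lt_top_iff_ne_top.2 fun h => hI ?_
  obtain ⟨r, hr, hr0⟩ := Submodule.exists_sub_one_mem_and_smul_eq_zero_of_fg_of_le_smul I
    (⊤ : Submodule R M) Module.Finite.fg_top h.ge
  have hrI : r ∈ I := hM (Module.mem_annihilator.2 fun m => hr0 m Submodule.mem_top)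
  rw [Ideal.eq_top_iff_one]
  simpa using I.sub_mem hrI hr

lemma length_le_supportDim_of_isRegular [IsNoetherianRing R] (rs : List R) (M : Type u)
    [AddCommGroup M] [Module R M] [Module.Finite R M] (h : IsRegular M rs) :
    (rs.length : WithBot ℕ∞) ≤ Module.supportDim R M := by
  induction rs generalizing M with
  | nil =>
    have : Nontrivial M := h.nontrivial
    obtain ⟨k, hk⟩ := WithBot.ne_bot_iff_exists.1 (Module.supportDim_ne_bot_of_nontrivial R M)
    rw [← hk]
    exact WithBot.coe_le_coe.2 (zero_le (a := k))
  | cons r rs ih =>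
    rw [isRegular_cons_iff] at h
    refine le_trans ?_ (Module.supportDim_quotSMulTop_succ_le_of_notMem_minimalPrimes
      fun _ => h.1.notMem_of_mem_minimalPrimes)
    push_cast [List.length_cons]
    exact add_le_add_left (ih _ h.2) 1

lemma RingTheory.Sequence.IsRegular.cons_of_mem_iff {I J : Ideal R} [I.IsPrime] {x : R}
    {rs : List R} (h : IsRegular (R ⧸ J) rs) (hx : x ∉ I)
    (hJ : ∀ f, f ∈ J ↔ ∃ c, ∃ p ∈ I, f = c * x + p) : IsRegular (R ⧸ I) (x :: rs) := by
  have hIJ : I ≤ J := fun p hp => (hJ p).2 ⟨0, p, hp, by ring⟩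
  have hker : x • (⊤ : Submodule R (R ⧸ I)) = LinearMap.ker (Submodule.factor hIJ) := by
    ext y
    obtain ⟨y, rfl⟩ := Submodule.mkQ_surjective _ y
    rw [Submodule.mem_smul_pointwise_iff_exists, LinearMap.mem_ker,
      Submodule.factor_mk, Submodule.mkQ_apply, Submodule.mkQ_apply,
      Submodule.Quotient.mk_eq_zero, hJ]
    constructor
    · rintro ⟨z, -, hz⟩
      obtain ⟨z, rfl⟩ := Submodule.mkQ_surjective _ z
      rw [Submodule.mkQ_apply, ← Submodule.Quotient.mk_smul, eq_comm, Submodule.Quotient.eq] at hz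
      exact ⟨z, _, hz, by rw [smul_eq_mul]; ring⟩
    · rintro ⟨c, p, hp, rfl⟩
      refine ⟨I.mkQ c, trivial, ?_⟩
      rw [Submodule.mkQ_apply, ← Submodule.Quotient.mk_smul, eq_comm, Submodule.Quotient.eq]
      simpa [mul_comm] using hp
  refine (isRegular_cons_iff _ _ _).2 ⟨?_, ?_⟩
  · refine isSMulRegular_iff_right_eq_zero_of_smul.2 fun y hy => ?_
    obtain ⟨y, rfl⟩ := Submodule.mkQ_surjective _ y
    rw [Submodule.mkQ_apply, ← Submodule.Quotient.mk_smul, Submodule.Quotient.mk_eq_zero,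
      smul_eq_mul] at hy
    exact (Submodule.Quotient.mk_eq_zero _).2 ((Ideal.IsPrime.mem_or_mem ‹_› hy).resolve_left hx)
  · exact ((Submodule.quotEquivOfEq _ _ hker).trans ((Submodule.factor hIJ).quotKerEquivOfSurjective
      (Submodule.factor_surjective hIJ)) |>.isRegular_congr rs).2 h

lemma CyclicFiltration.exists_mem {M : Type*} [AddCommGroup M] [Module R M] [Nontrivial M]
    {L : List (Ideal R)} (h : CyclicFiltration (⊥ : Submodule R M) ⊤ L) : ∃ P, P ∈ L := by
  have hne : (⊥ : Submodule R M) ≠ ⊤ := bot_ne_top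
  generalize (⊥ : Submodule R M) = A, (⊤ : Submodule R M) = B at h hne
  cases h with
  | refl => exact absurd rfl hne
  | cons => exact ⟨_, List.mem_cons_self⟩

lemma CyclicFiltration.ringKrullDim_quotient_annihilator {M : Type*} [AddCommGroup M] [Module R M]
    [Nontrivial M] {L : List (Ideal R)} {i : ℕ} (h : CyclicFiltration (⊥ : Submodule R M) ⊤ L)
    (hL : ∀ P ∈ L, ringKrullDim (R ⧸ P) = i) :
    ringKrullDim (R ⧸ Module.annihilator R M) = i := by
  apply le_antisymm
  · rw [ringKrullDim_quotient, Order.krullDim]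
    refine iSup_le fun p => ?_
    obtain ⟨P, hP, hle⟩ := h.exists_le_of_annihilator_le p.head.1.2 p.head.2
    rw [← hL P hP, ringKrullDim_quotient]
    exact Order.LTSeries.length_le_krullDim (α := PrimeSpectrum.zeroLocus (P : Set R))
      ⟨p.length, fun j => ⟨(p j).1, hle.trans (p.head_le j)⟩, p.step⟩
  · obtain ⟨P, hP⟩ := h.exists_mem
    exact (hL P hP).ge.trans (ringKrullDim_quotient_anti (h.annihilator_le hP))

lemma CyclicFiltration.isCM [IsNoetherianRing R] {M : Type u} [AddCommGroup M] [Module R M]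
    [Nontrivial M] [Module.Finite R M] {L : List (Ideal R)} {i : ℕ} {m : Ideal R} (hm : m ≠ ⊤)
    (h : CyclicFiltration (⊥ : Submodule R M) ⊤ L)
    (hL : ∀ P ∈ L, P ≤ m ∧ ringKrullDim (R ⧸ P) = i ∧
      ∃ rs : List R, rs.length = i ∧ (∀ r ∈ rs, r ∈ m) ∧ IsRegular (R ⧸ P) rs) :
    IsCM R m M := by
  have hdim := h.ringKrullDim_quotient_annihilator fun P hP => (hL P hP).2.1
  obtain ⟨P, hP⟩ := h.exists_mem
  have hext (j : ℕ) (hj : j < i) : Subsingleton (Ext (ModuleCat.of R (R ⧸ m))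
      (ModuleCat.of R (M ⧸ (⊥ : Submodule R M))) j) := by
    refine h.subsingleton_ext rfl _ j fun P hP => ?_
    obtain ⟨hPm, -, rs, hlen, hmem, hrs⟩ := hL P hP
    refine ModuleCat.subsingleton_ext_of_exists_isRegular m _ ?_ (ModuleCat.of R (R ⧸ P))
      (smul_top_lt_top_of_annihilator_le hm (by rwa [Ideal.annihilator_quotient])) rs hmem hrs j
      (hlen ▸ hj)
    rw [Module.support_eq_zeroLocus, Ideal.annihilator_quotient]
  let e := Submodule.quotEquivOfEqBot (⊥ : Submodule R M) rfl
  obtain ⟨rs, hlen, hmem, hrs⟩ := ModuleCat.exists_isRegular_of_exists_subsingleton_ext m i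
    (ModuleCat.of R (M ⧸ (⊥ : Submodule R M)))
    (smul_top_lt_top_of_annihilator_le hm
      (e.annihilator_eq.trans_le ((h.annihilator_le hP).trans (hL P hP).1)))
    (ModuleCat.of R (R ⧸ m)) (by rw [Module.support_eq_zeroLocus, Ideal.annihilator_quotient]) hext
  rw [IsCM, hdim, mDepth]
  refine congrArg _ (le_antisymm (sSup_le ?_) (le_sSup ?_))
  · rintro _ ⟨rs, rfl, -, hrs⟩
    have := length_le_supportDim_of_isRegular rs M hrs
    rw [Module.supportDim_eq_ringKrullDim_quotient_annihilator, hdim] at this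
    exact_mod_cast this
  · exact ⟨rs, by rw [hlen], hmem, (e.isRegular_congr rs).1 hrs⟩

end General

lemma exists_isRegular_quotient_variableIdeal (d : ℕ) (A : Finset (Fin n)) (hA : Aᶜ.card = d) :
    ∃ rs : List Sn, rs.length = d ∧ (∀ r ∈ rs, r ∈ mn) ∧
      IsRegular (Sn ⧸ variableIdeal K A) rs := by
  have := variableIdeal_isPrime (K := K) A
  induction d generalizing A with
  | zero => exact ⟨[], rfl, by simp, IsRegular.nil _ _⟩
  | succ d ih =>
    obtain ⟨a, ha⟩ := Finset.card_pos.1 (hA.symm ▸ d.succ_pos : 0 < Aᶜ.card)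
    rw [Finset.mem_compl] at ha
    obtain ⟨rs, hlen, hmem, hrs⟩ := ih (insert a A)
      (by rw [Finset.compl_insert, Finset.card_erase_of_mem (Finset.mem_compl.2 ha), hA]; rfl)
      (variableIdeal_isPrime _)
    refine ⟨X a :: rs, by simp [hlen], ?_, hrs.cons_of_mem_iff
      (fun h => ha (X_mem_variableIdeal.1 h))
      fun f => mem_variableIdeal_insert⟩
    simpa using ⟨Ideal.subset_span ⟨a, rfl⟩, hmem⟩


lemma irrelevant_ne_top : mn ≠ ⊤ := fun h => by
  have := (variableIdeal_isPrime (K := K) (Finset.univ : Finset (Fin n))).ne_top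
  rw [variableIdeal, Finset.coe_univ, Set.image_univ] at this
  exact this h


end CohenMacaulay

/-- For a monomial ideal `I ⊆ K[x₁,…,xₙ]` with dimension filtration
`I = D₋₁(I) ⊆ D₀(I) ⊆ ... ⊆ D_{n-1}(I) = S` (here `D i` denotes `D_{i-1}(I)`),
the following are equivalent: (1) `S/I` is pretty clean; (2) `S/I` is
sequentially Cohen–Macaulay and all nonzero factors of the dimension filtration
are clean `S`-modules; (3) all nonzero factors of the dimension filtration are
clean `S`-modules. -/
theorem stmt_4 (I : Ideal Sn) (hI : IsMonomialIdeal I)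
    (Q : Ideal Sn → Ideal Sn)
    (hQ : ∀ p ∈ associatedPrimes Sn (Sn ⧸ I), (Q p).IsPrimary ∧ (Q p).radical = p)
    (hdec : I = ⨅ p ∈ associatedPrimes Sn (Sn ⧸ I), Q p)
    (hirr : ∀ p ∈ associatedPrimes Sn (Sn ⧸ I),
      I ≠ ⨅ q ∈ associatedPrimes Sn (Sn ⧸ I) \ {p}, Q q)
    (D : ℕ → Ideal Sn) (hD0 : D 0 = I)
    (hD : ∀ i : ℕ, D (i + 1) =
      ⨅ p ∈ {p | p ∈ associatedPrimes Sn (Sn ⧸ I) ∧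
        (i : WithBot ℕ∞) < ringKrullDim (Sn ⧸ p)}, Q p) :
    [ IsPrettyClean I,
      (∀ i < n, Submodule.map (D i).mkQ (D (i + 1)) ≠ ⊥ →
          IsCM Sn mn ↥(Submodule.map (D i).mkQ (D (i + 1)))) ∧
        (∀ i < n, Submodule.map (D i).mkQ (D (i + 1)) ≠ ⊥ →
          IsCleanModule Sn ↥(Submodule.map (D i).mkQ (D (i + 1)))),
      ∀ i < n, Submodule.map (D i).mkQ (D (i + 1)) ≠ ⊥ →
        IsCleanModule Sn ↥(Submodule.map (D i).mkQ (D (i + 1))) ].TFAE := by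
  have hT : IsTorsionFiltration I D := isTorsionFiltration_of_primaryDecomposition hQ hdec hD0 hD
  tfae_have 1 → 2 := by
    intro h
    refine ⟨fun i _ hi => ?_, fun i _ hi => ?_⟩ <;>
      obtain ⟨L, hL, hLA⟩ := h.exists_cyclicFiltration_factor hI hT i
    · have := Submodule.nontrivial_iff_ne_bot.2 hi
      refine hL.isCM (i := i) irrelevant_ne_top fun P hP => ?_
      obtain ⟨A, rfl, hA⟩ := hLA P hP
      exact ⟨variableIdeal_le_irrelevant A, ringKrullDim_quotient_variableIdeal hA,
        exists_isRegular_quotient_variableIdeal i A hA⟩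
    · exact isCleanModule_iff_cyclicFiltration.2 ⟨L, hL, hL.mem_minimalPrimes hLA⟩
  tfae_have 2 → 3 := And.right
  tfae_have 3 → 1 := by
    intro h
    refine hT.isPrettyClean_of_isCleanModule (m := n) ?_ h hD0
    simp [MvPolynomial.ringKrullDim_of_isNoetherianRing]
  tfae_finish
end
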